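/- arXiv:1403.3736 — 3 statements merged into one kernel-verified Lean document; each statement's English description precedes it below -/
import Mathlib

section
/- Let E be a real vector space, U ⊆ E a nonempty convex subset, and F : U → ℝ a function that is C^n at a point f ∈ U. Then: (i) for every permutation τ of {1,…,n}, d^nF(f; g₁, …, g_n) = d^nF(f; g_{τ(1)}, …, g_{τ(n)}) for all g₁, …, g_n ∈ Adm_U(f); and (ii) the map (g₁, …, g_n) ↦ d^nF(f; g₁, …, g_n) on Adm_U(f)^n extends (uniquely) to a multilinear functional on (span_ℝ Adm_U(f))^n. -/
open MeasureTheory Filter Set Topology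
open scoped BigOperators Classical ENNReal

noncomputable section

/-- The type of kernels: functions `[0,1]² → ℝ` (formalized as functions on all of `ℝ²`). -/
abbrev Kern : Type := ℝ → ℝ → ℝ

/-- Lebesgue measure restricted to `[0,1]`. -/
abbrev μ01 : Measure ℝ := volume.restrict (Set.Icc 0 1)

/-- Symmetric measurable function. -/
def IsSymmMeas (f : Kern) : Prop :=
  Measurable (Function.uncurry f) ∧ ∀ x y, f x y = f y x

/-- Membership in the space `𝒲` of bounded symmetric measurable functions. -/
def IsKernel (f : Kern) : Prop := IsSymmMeas f ∧ ∃ C : ℝ, ∀ x y, |f x y| ≤ C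

/-- A graphon: a symmetric measurable function with values in `[0,1]`. -/
def IsGraphon (f : Kern) : Prop := IsSymmMeas f ∧ ∀ x y, f x y ∈ Set.Icc (0:ℝ) 1

/-- The set `W` of graphons. -/
def Graphons : Set Kern := {f | IsGraphon f}

/-- A multigraph (no loops, multiple edges allowed), with vertex set `Fin nv` and
edge (multi)set indexed by `Fin ne`, the edge `e` having endpoints `s e`, `t e`. -/
structure MG where
  nv : ℕ
  ne : ℕ
  s : Fin ne → Fin nv
  t : Fin ne → Fin nv
  noLoop : ∀ e, s e ≠ t e

/-- The homomorphism density `t(G, f)` of a multigraph `G` in a kernel `f`. -/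
def homDensity (G : MG) (f : Kern) : ℝ :=
  ∫ x : Fin G.nv → ℝ, ∏ e : Fin G.ne, f (x (G.s e)) (x (G.t e))
    ∂(Measure.pi fun _ => μ01)

/-- A node-and-edge homomorphism of multigraphs. -/
structure MGHom (G H : MG) where
  vMap : Fin G.nv → Fin H.nv
  eMap : Fin G.ne → Fin H.ne
  compat : ∀ e, ({H.s (eMap e), H.t (eMap e)} : Finset (Fin H.nv))
      = {vMap (G.s e), vMap (G.t e)}

/-- A surjective node-and-edge homomorphism. -/
def MGHom.Surj {G H : MG} (φ : MGHom G H) : Prop :=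
  Function.Surjective φ.vMap ∧ Function.Surjective φ.eMap

/-- A bijective node-and-edge homomorphism. -/
def MGHom.Bij {G H : MG} (φ : MGHom G H) : Prop :=
  Function.Bijective φ.vMap ∧ Function.Bijective φ.eMap

instance (G H : MG) : Finite (MGHom G H) := by
  have hinj : Function.Injective (fun φ : MGHom G H => (φ.vMap, φ.eMap)) := by
    rintro ⟨v1, e1, h1⟩ ⟨v2, e2, h2⟩ h
    simp only [Prod.mk.injEq] at h
    obtain ⟨hv, he⟩ := h
    subst hv; subst he; rfl
  exact Finite.of_injective _ hinj

/-- Isomorphism of multigraphs. -/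
def MGIso (G H : MG) : Prop := ∃ φ : MGHom G H, φ.Bij

/-- A multigraph with no isolated vertices. -/
def NoIsolated (G : MG) : Prop := ∀ v, ∃ e, G.s e = v ∨ G.t e = v

/-- A multigraph is simple if no two (distinct) edges have the same pair of endpoints. -/
def IsSimpleMG (G : MG) : Prop :=
  ∀ e e', ({G.s e, G.t e} : Finset (Fin G.nv)) = ({G.s e', G.t e'} : Finset (Fin G.nv))
    → e = e'

/-- A class function on graphon space: it only depends on the homomorphism densities
with respect to finite simple graphs. -/
def IsClassFun (F : Kern → ℝ) : Prop :=
  ∀ f g, IsGraphon f → IsGraphon g →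
    (∀ G : MG, IsSimpleMG G → homDensity G f = homDensity G g) → F f = F g

/-- The `L¹` distance between two kernels (on the square `[0,1]²`). -/
def l1Dist (f g : Kern) : ℝ := ∫ x, ∫ y, |f x y - g x y| ∂μ01 ∂μ01

/-- Continuity on the set of graphons with respect to the `L¹` norm. -/
def L1ContOn (F : Kern → ℝ) : Prop :=
  ∀ f ∈ Graphons, ∀ ε : ℝ, 0 < ε → ∃ δ : ℝ, 0 < δ ∧
    ∀ g ∈ Graphons, l1Dist f g < δ → |F f - F g| < ε

/-- The cut norm of a kernel. -/
def cutNorm (f : Kern) : ℝ :=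
  sSup {r : ℝ | ∃ S T : Set ℝ, MeasurableSet S ∧ MeasurableSet T ∧
    S ⊆ Set.Icc 0 1 ∧ T ⊆ Set.Icc 0 1 ∧ r = |∫ x in S, ∫ y in T, f x y|}

/-- Continuity on the set of graphons with respect to the cut norm. -/
def CutContOn (F : Kern → ℝ) : Prop :=
  ∀ f ∈ Graphons, ∀ ε : ℝ, 0 < ε → ∃ δ : ℝ, 0 < δ ∧
    ∀ g ∈ Graphons, cutNorm (f - g) < δ → |F f - F g| < ε

section Gateaux

variable {E : Type*} [AddCommGroup E] [Module ℝ E]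

/-- Admissible directions at `f` for a convex subset `U` of a real vector space:
directions `g` so that `f + ε g ∈ U` for all sufficiently small `ε ∈ [0,1)`. -/
def adm (U : Set E) (f : E) : Set E :=
  {g | ∃ ε₀ : ℝ, 0 < ε₀ ∧ ε₀ ≤ 1 ∧ ∀ ε : ℝ, 0 ≤ ε → ε < ε₀ → f + ε • g ∈ U}

/-- Iterated mixed Gâteaux derivative `d^n F(f; g₁, …, g_n)` of `F : U → ℝ`, computed
through one-sided difference quotients restricted to `U`; the derivative in the last
direction is taken first.  (The value is given by `Filter.limUnder`, i.e. it is the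
limit of the difference quotients whenever this limit exists.) -/
def gD (U : Set E) (F : E → ℝ) : (n : ℕ) → E → (Fin n → E) → ℝ
  | 0 => fun f _ => F f
  | n + 1 => fun f g =>
      limUnder (nhdsWithin (0:ℝ) {t : ℝ | t ≠ 0 ∧ f + t • g (Fin.last n) ∈ U})
        (fun t => (gD U F n (f + t • g (Fin.last n)) (fun i => g i.castSucc)
              - gD U F n f (fun i => g i.castSucc)) / t)

/-- `F` is `n` times Gâteaux differentiable on `U`: all iterated Gâteaux derivatives
up to order `n` in admissible directions exist (i.e. the corresponding difference
quotients genuinely converge). -/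
def GDiffN (U : Set E) (F : E → ℝ) : ℕ → Prop
  | 0 => True
  | n + 1 => GDiffN U F n ∧
      ∀ f ∈ U, ∀ g : Fin (n+1) → E, (∀ i, g i ∈ adm U f) →
        Tendsto
          (fun t : ℝ => (gD U F n (f + t • g (Fin.last n)) (fun i => g i.castSucc)
              - gD U F n f (fun i => g i.castSucc)) / t)
          (nhdsWithin (0:ℝ) {t : ℝ | t ≠ 0 ∧ f + t • g (Fin.last n) ∈ U})
          (nhds (gD U F (n+1) f g))

/-- `F : U → ℝ` is `C^n` at `f`: for any admissible directions `g₁, …, g_m`, the map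
`(λ₁, …, λ_m) ↦ F(f + Σᵢ λᵢ gᵢ)` admits a `C^n` extension to all of `ℝ^m`. -/
def IsCnAt (U : Set E) (F : E → ℝ) (n : ℕ) (f : E) : Prop :=
  ∀ (m : ℕ) (g : Fin m → E), (∀ i, g i ∈ adm U f) →
    ∃ G : (Fin m → ℝ) → ℝ, ContDiff ℝ n G ∧
      ∀ lam : Fin m → ℝ, f + ∑ i, lam i • g i ∈ U → G lam = F (f + ∑ i, lam i • g i)

/-- `F` is `C^n` (everywhere on `U`). -/
def IsCn (U : Set E) (F : E → ℝ) (n : ℕ) : Prop := ∀ f ∈ U, IsCnAt U F n f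

/-- `F` is Gâteaux smooth: `C^n` at every point for every `n`. -/
def GSmooth (U : Set E) (F : E → ℝ) : Prop := ∀ n : ℕ, IsCn U F n

end Gateaux

/-- Iso-invariance of a family of constants indexed by multigraphs. -/
def IsoInvariant (a : MG → ℝ) : Prop := ∀ G H, MGIso G H → a G = a H

/-- Coefficients indexed by the isomorphism classes of multigraphs with at most `N`
edges and no isolated vertices (encoded as iso-invariant families of constants
vanishing outside this class of multigraphs). -/
def GoodCoeffs (N : ℕ) (a : MG → ℝ) : Prop :=
  IsoInvariant a ∧ ∀ G : MG, ¬(G.ne ≤ N ∧ NoIsolated G) → a G = 0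

/-- A functional on `W^n` is multilinear if its restriction to tuples from the
subspace `𝒲` (= span of `W`) is linear in each coordinate. -/
def MultilinearOnKerns (n : ℕ) (Λ : (Fin n → Kern) → ℝ) : Prop :=
  (∀ (g : Fin n → Kern), (∀ j, IsKernel (g j)) → ∀ (i : Fin n) (u v : Kern),
      IsKernel u → IsKernel v →
      Λ (Function.update g i (u + v))
        = Λ (Function.update g i u) + Λ (Function.update g i v)) ∧
  (∀ (g : Fin n → Kern), (∀ j, IsKernel (g j)) → ∀ (i : Fin n) (c : ℝ) (u : Kern),
      IsKernel u →
      Λ (Function.update g i (c • u)) = c * Λ (Function.update g i u))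

/-- A functional on `W^n` extends to a multilinear functional on `(span ℝ W)^n`. -/
def IsMultilinearOnW (n : ℕ) (Λ : (Fin n → Kern) → ℝ) : Prop :=
  ∃ L : MultilinearMap ℝ (fun _ : Fin n => ↥(Submodule.span ℝ Graphons)) ℝ,
    ∀ (g : Fin n → Kern) (h : ∀ i, g i ∈ Graphons),
      L (fun i => ⟨g i, Submodule.subset_span (h i)⟩) = Λ g

/-- An invertible Lebesgue-measure-preserving bijection of `[0,1]`. -/
def IsMPB (σ : ℝ → ℝ) : Prop :=
  MeasurePreserving σ μ01 μ01 ∧ Set.BijOn σ (Set.Icc 0 1) (Set.Icc 0 1)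

/-- The action `f ↦ f^σ` of maps of `[0,1]` on kernels. -/
def Kern.translate (σ : ℝ → ℝ) (f : Kern) : Kern := fun x y => f (σ x) (σ y)

/-- The cell `((a)/p, (a+1)/p]` of the regular partition of `[0,1]` (`a = 0, …, p-1`). -/
def cell (p : ℕ) (a : Fin p) : Set ℝ :=
  Set.Ioc (((a : ℕ) : ℝ) / (p : ℝ)) ((((a : ℕ) : ℝ) + 1) / (p : ℝ))

/-- The basic step graphon `e^p_(a,b)`: symmetrized indicator of `cell a × cell b`. -/
def ep (p : ℕ) (a b : Fin p) : Kern := fun x y =>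
  if (x ∈ cell p a ∧ y ∈ cell p b) ∨ (x ∈ cell p b ∧ y ∈ cell p a) then 1 else 0

/-- The step kernel with values `c a b` on the cell `cell a × cell b` (`a ≠ b`) and `0`
on the diagonal cells and outside `(0,1]²`. -/
def stepFn (p : ℕ) (c : Fin p → Fin p → ℝ) : Kern := fun x y =>
  ∑ a : Fin p, ∑ b : Fin p, if a ≠ b ∧ x ∈ cell p a ∧ y ∈ cell p b then c a b else 0

/-- The set `W_𝐩 = ⋃ₚ W_p` of step graphons. -/
def StepGraphons : Set Kern := {f | IsGraphon f ∧ ∃ p c, f = stepFn p c}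

/-- The union of the `S_[0,1]`-translates of `W_𝐩`. -/
def StepTranslates : Set Kern :=
  {f | ∃ σ : ℝ → ℝ, IsMPB σ ∧ ∃ g ∈ StepGraphons, f = Kern.translate σ g}

/-- Add `m` isolated vertices to a multigraph. -/
def MG.pad (G : MG) (m : ℕ) : MG where
  nv := G.nv + m
  ne := G.ne
  s := fun e => Fin.castAdd m (G.s e)
  t := fun e => Fin.castAdd m (G.t e)
  noLoop := fun e h => G.noLoop e (by
    apply Fin.ext
    simpa using congrArg Fin.val h)

/-- Two multigraphs become isomorphic after deleting isolated vertices (equivalently,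
after adding enough isolated vertices). -/
def StripEquiv (G H : MG) : Prop := ∃ a b : ℕ, MGIso (G.pad a) (H.pad b)

/-- A tuple of pairs of distinct indices in `Fin p` (encoding a tuple in `E_p^n`). -/
def ValidTuple (p n : ℕ) (x : Fin n → Fin p × Fin p) : Prop := ∀ l, (x l).1 ≠ (x l).2

/-- The multigraph `Γ_{n,p}(x)` associated to a tuple `x ∈ E_p^n`. -/
def tupleMG (p n : ℕ) (x : Fin n → Fin p × Fin p) (hx : ValidTuple p n x) : MG :=
  ⟨p, n, fun l => (x l).1, fun l => (x l).2, hx⟩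

/-- Symmetry of a functional on `W^n` under permutation of arguments. -/
def SymmFunc (n : ℕ) (Λ : (Fin n → Kern) → ℝ) : Prop :=
  ∀ (g : Fin n → Kern), (∀ i, g i ∈ Graphons) → ∀ τ : Equiv.Perm (Fin n),
    Λ (g ∘ τ) = Λ g

/-- `S_[0,1]`-invariance of a functional on `W^n`. -/
def SInvFunc (n : ℕ) (Λ : (Fin n → Kern) → ℝ) : Prop :=
  ∀ (g : Fin n → Kern), (∀ i, g i ∈ Graphons) → ∀ σ : ℝ → ℝ, IsMPB σ →
    Λ (fun i => Kern.translate σ (g i)) = Λ g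

/-- `π` is the consistency-constraint matrix `π_{n,k}`: it is invariant under
isomorphism-after-deleting-isolated-vertices in both arguments, and for every `p ≥ 2`,
every symmetric `S_[0,1]`-invariant multilinear functional `Λ : W^n → ℝ`, every
`x ∈ E_p^n` and every complete system `y` of pairwise non-isomorphic representatives
of the multigraphs with `n` edges on `kp` vertices, one has
`C_{n,p}(Λ)(Γ(x)) = Σ_h π(Γ(x)∼, h∼) C_{n,kp}(Λ)(h)`. -/
def ConsistencyMatrix (n k : ℕ) (π : MG → MG → ℕ) : Prop :=
  (∀ G G' H H', StripEquiv G G' → StripEquiv H H' → π G H = π G' H') ∧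
  ∀ p : ℕ, 2 ≤ p → ∀ Λ : (Fin n → Kern) → ℝ,
    SymmFunc n Λ → SInvFunc n Λ → MultilinearOnKerns n Λ →
    ∀ (x : Fin n → Fin p × Fin p) (hx : ValidTuple p n x),
    ∀ (m : ℕ) (y : Fin m → Fin n → Fin (k*p) × Fin (k*p))
      (hy : ∀ i, ValidTuple (k*p) n (y i)),
      (∀ i j, i ≠ j →
        ¬ MGIso (tupleMG (k*p) n (y i) (hy i)) (tupleMG (k*p) n (y j) (hy j))) →
      (∀ (z : Fin n → Fin (k*p) × Fin (k*p)) (hz : ValidTuple (k*p) n z),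
        ∃ i, MGIso (tupleMG (k*p) n z hz) (tupleMG (k*p) n (y i) (hy i))) →
      Λ (fun l => ep p (x l).1 (x l).2)
        = ∑ i : Fin m,
            (π (tupleMG p n x hx) (tupleMG (k*p) n (y i) (hy i)) : ℝ)
              * Λ (fun l => ep (k*p) (y i l).1 (y i l).2)

/-- Adjacency relation of a multigraph. -/
def MG.adj (G : MG) (u v : Fin G.nv) : Prop :=
  ∃ e, (G.s e = u ∧ G.t e = v) ∨ (G.s e = v ∧ G.t e = u)

/-- The homomorphism density of the simplification `G^simp` of a multigraph `G`
(replace each family of parallel edges by a single edge). -/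
def simpHomDensity (G : MG) (f : Kern) : ℝ :=
  ∫ x : Fin G.nv → ℝ,
    ∏ q ∈ Finset.univ.filter (fun q : Fin G.nv × Fin G.nv => q.1 < q.2 ∧ G.adj q.1 q.2),
      f (x q.1) (x q.2) ∂(Measure.pi fun _ => μ01)

/-- Tensor product of two kernels with respect to a fixed measure-preserving map
`φ : [0,1] → [0,1]²`. -/
def tensProd (φ : ℝ → ℝ × ℝ) (f g : Kern) : Kern :=
  fun x y => f (φ x).1 (φ y).1 * g (φ x).2 (φ y).2

/-- `m`-fold tensor power of a kernel. -/
def tensPow (φ : ℝ → ℝ × ℝ) (f : Kern) : ℕ → Kern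
  | 0 => fun _ _ => 1
  | 1 => f
  | (m+2) => tensProd φ f (tensPow φ f (m+1))

/-- A complete system of representatives for the isomorphism classes of multigraphs
with no isolated vertices. -/
def IsRepSet (R : Set MG) : Prop :=
  (∀ G ∈ R, NoIsolated G) ∧ ∀ G : MG, NoIsolated G → ∃! H, H ∈ R ∧ MGIso G H

/-- A `k`-labelled multigraph: a multigraph together with an injective labelling of `k`
distinguished vertices. -/
structure LMG (k : ℕ) where
  G : MG
  lab : Fin k → Fin G.nv
  inj : Function.Injective lab

/-- No unlabelled isolated vertices. -/
def LMG.NoUnlabIsolated {k : ℕ} (H : LMG k) : Prop :=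
  ∀ v, (∃ e, H.G.s e = v ∨ H.G.t e = v) ∨ ∃ a, H.lab a = v

/-- Assignment of coordinates to the vertices of a `k`-labelled multigraph: labelled
vertices get the fixed values `x`, unlabelled ones the integration variables `y`. -/
def LMG.assign {k : ℕ} (H : LMG k) (x : Fin k → ℝ) (y : Fin H.G.nv → ℝ) :
    Fin H.G.nv → ℝ :=
  fun v => if h : ∃ a, H.lab a = v then x h.choose else y v

/-- The partially labelled homomorphism density `t_𝐱(H, f)`. -/
def lhom {k : ℕ} (H : LMG k) (x : Fin k → ℝ) (f : Kern) : ℝ :=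
  ∫ y : Fin H.G.nv → ℝ,
    ∏ e : Fin H.G.ne, f (H.assign x y (H.G.s e)) (H.assign x y (H.G.t e))
    ∂(Measure.pi fun _ => μ01)

/-- The weighted partially labelled homomorphism density `t_𝐱(H, f; w)`. -/
def wlhom {k : ℕ} (H : LMG k) (x : Fin k → ℝ) (f : Kern)
    (w : (Fin H.G.nv → ℝ) → ℝ) : ℝ :=
  ∫ y : Fin H.G.nv → ℝ,
    w (H.assign x y) *
      ∏ e : Fin H.G.ne, f (H.assign x y (H.G.s e)) (H.assign x y (H.G.t e))
    ∂(Measure.pi fun _ => μ01)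

/-- The seminorm `‖w‖_{1,𝐱} = t_𝐱(H, 1, |w|)` of a weight. -/
def wnorm {k : ℕ} (H : LMG k) (x : Fin k → ℝ) (w : (Fin H.G.nv → ℝ) → ℝ) : ℝ :=
  ∫ y : Fin H.G.nv → ℝ, |w (H.assign x y)| ∂(Measure.pi fun _ => μ01)

/-- Label-respecting isomorphism of `k`-labelled multigraphs. -/
def LMGIso {k : ℕ} (H H' : LMG k) : Prop :=
  ∃ (φv : Fin H.G.nv ≃ Fin H'.G.nv) (φe : Fin H.G.ne ≃ Fin H'.G.ne),
    (∀ e, ({H'.G.s (φe e), H'.G.t (φe e)} : Finset (Fin H'.G.nv))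
        = {φv (H.G.s e), φv (H.G.t e)}) ∧
    ∀ a, φv (H.lab a) = H'.lab a

/-- A complete system of representatives for the label-respecting isomorphism classes
of `k`-labelled multigraphs with no unlabelled isolated vertices. -/
def IsLRepSet (k : ℕ) (R : Set (LMG k)) : Prop :=
  (∀ H ∈ R, H.NoUnlabIsolated) ∧
  ∀ H : LMG k, H.NoUnlabIsolated → ∃! H', H' ∈ R ∧ LMGIso H H'

end


section Aux

variable {E : Type*} [AddCommGroup E] [Module ℝ E]

lemma aux_adm_shift {U : Set E} (hconv : Convex ℝ U) {x g h : E} {s θ : ℝ}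
    (hs : x + s • g ∈ U) (h0 : 0 ≤ θ) (h1 : θ < 1) (hh : h ∈ adm U x) :
    h ∈ adm U (x + (θ * s) • g) := by
  obtain ⟨ε, hε, hε1, H⟩ := hh
  have hθ : 0 < 1 - θ := by linarith
  refine ⟨ε * (1 - θ), by positivity, by nlinarith, fun δ hδ hδ' => ?_⟩
  have hU : x + (δ / (1 - θ)) • h ∈ U := by
    apply H
    · positivity
    · rwa [div_lt_iff₀ hθ]
  have := hconv hs hU h0 hθ.le (by ring)
  convert this using 1
  have e : (1 - θ) * (δ / (1 - θ)) = δ := by field_simp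
  rw [smul_add, smul_add, smul_smul, smul_smul, e]
  module

lemma aux_adm_eventually {U : Set E} (hconv : Convex ℝ U) {x g : E}
    (hg : g ∈ adm U x) :
    ∀ᶠ t in nhdsWithin (0:ℝ) {t : ℝ | t ≠ 0 ∧ x + t • g ∈ U},
      ∀ h ∈ adm U x, h ∈ adm U (x + t • g) := by
  obtain ⟨ε, hε, hε1, H⟩ := hg
  have hp : x + (ε / 2) • g ∈ U := H _ (by positivity) (by linarith)
  have key : ∀ s : ℝ, x + s • g ∈ U → ∀ t, 0 ≤ t / s → t / s < 1 → s ≠ 0 →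
      ∀ h ∈ adm U x, h ∈ adm U (x + t • g) := by
    intro s hs t h0 h1 hs0 h hh
    have := aux_adm_shift hconv hs h0 h1 hh
    rwa [div_mul_cancel₀ _ hs0] at this
  have pos : ∀ t : ℝ, 0 < t → t < ε / 2 → ∀ h ∈ adm U x, h ∈ adm U (x + t • g) := by
    intro t h0 h1
    refine key _ hp t (by positivity) ?_ (by positivity)
    rw [div_lt_one (by positivity)]; exact h1
  by_cases hneg : ∃ s : ℝ, s < 0 ∧ x + s • g ∈ U
  · obtain ⟨s, hs, hsU⟩ := hneg
    rw [eventually_nhdsWithin_iff]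
    filter_upwards [Ioo_mem_nhds hs (by positivity : 0 < ε / 2)] with t ht htm
    rcases lt_or_gt_of_ne htm.1 with h | h
    · refine key s hsU t (div_nonneg_of_nonpos h.le hs.le) ?_ hs.ne
      rw [div_lt_one_of_neg hs]; exact ht.1
    · exact pos t h ht.2
  · push Not at hneg
    rw [eventually_nhdsWithin_iff]
    filter_upwards [Iio_mem_nhds (by positivity : 0 < ε / 2)] with t ht htm
    rcases lt_or_gt_of_ne htm.1 with h | h
    · exact absurd htm.2 (hneg t h)
    · exact pos t h ht

lemma aux_neBot {U : Set E} {x g : E} (hg : g ∈ adm U x) :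
    (nhdsWithin (0:ℝ) {t : ℝ | t ≠ 0 ∧ x + t • g ∈ U}).NeBot := by
  obtain ⟨ε, hε, hε1, H⟩ := hg
  have : (nhdsWithin (0:ℝ) (Ioo 0 ε)).NeBot := by
    rw [nhdsWithin_Ioo_eq_nhdsGT hε]; infer_instance
  exact this.mono (nhdsWithin_mono _ fun t ht => ⟨ht.1.ne', H t ht.1.le ht.2⟩)

/-- Key identity between Gâteaux derivatives and derivatives of the extension. -/
lemma aux_key {U : Set E} (hconv : Convex ℝ U) (F : E → ℝ) (n : ℕ) (f : E) {m : ℕ}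
    (φ : (Fin m → ℝ) →ₗ[ℝ] E) (G : (Fin m → ℝ) → ℝ) (hG : ContDiff ℝ n G)
    (hGF : ∀ l, f + φ l ∈ U → G l = F (f + φ l)) :
    ∀ k : ℕ, k ≤ n → ∀ (l : Fin m → ℝ), f + φ l ∈ U → ∀ c : Fin k → (Fin m → ℝ),
      (∀ i, φ (c i) ∈ adm U (f + φ l)) →
      gD U F k (f + φ l) (fun i => φ (c i)) = iteratedFDeriv ℝ k G l (fun i => c i.rev) := by
  intro k
  induction k with
  | zero =>
    intro _ l hl c _
    simp [gD, hGF l hl]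
  | succ k ih =>
    intro hk l hl c hc
    have hlast := hc (Fin.last k)
    have := aux_neBot hlast
    simp only [gD]
    apply Tendsto.limUnder_eq
    have hdiff : Differentiable ℝ (iteratedFDeriv ℝ k G) :=
      hG.differentiable_iteratedFDeriv (by exact_mod_cast hk)
    have hline : HasDerivAt (fun t : ℝ => iteratedFDeriv ℝ k G (l + t • c (Fin.last k))
        (fun i => c i.rev.castSucc))
        (iteratedFDeriv ℝ (k+1) G l (fun i => c i.rev)) 0 := by
      have h1 : HasDerivAt (fun t : ℝ => l + t • c (Fin.last k)) (c (Fin.last k)) 0 := by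
        simpa using ((hasDerivAt_id (0:ℝ)).smul_const (c (Fin.last k))).const_add l
      have h2 : HasFDerivAt (iteratedFDeriv ℝ k G) (fderiv ℝ (iteratedFDeriv ℝ k G) l)
          (l + (0:ℝ) • c (Fin.last k)) := by
        simpa using (hdiff l).hasFDerivAt
      have h3 := h2.comp_hasDerivAt (0:ℝ) h1
      have h4 := ((ContinuousMultilinearMap.apply ℝ (fun _ : Fin k => (Fin m → ℝ)) ℝ
        (fun i => c i.rev.castSucc)).hasFDerivAt).comp_hasDerivAt (0:ℝ) h3
      refine h4.congr_deriv ?_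
      symm
      rw [iteratedFDeriv_succ_apply_left]
      simp [Fin.tail_def, Fin.rev_succ]
    rw [hasDerivAt_iff_tendsto_slope_zero] at hline
    have hline' := hline.mono_left (nhdsWithin_mono (0:ℝ)
      (fun t ht => ht.1 : {t : ℝ | t ≠ 0 ∧ f + φ l + t • φ (c (Fin.last k)) ∈ U} ⊆ {0}ᶜ))
    refine hline'.congr' ?_
    have hself := ih (by omega) l hl (fun i => c i.castSucc) (fun i => hc _)
    filter_upwards [aux_adm_eventually hconv hlast, self_mem_nhdsWithin] with t ht htm
    have e : f + φ l + t • φ (c (Fin.last k)) = f + φ (l + t • c (Fin.last k)) := by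
      simp [add_assoc]
    have h5 := ih (by omega) (l + t • c (Fin.last k)) (by rw [← e]; exact htm.2)
      (fun i => c i.castSucc) (fun i => by rw [← e]; exact ht _ (hc _))
    rw [e, h5, hself]
    simp [div_eq_inv_mul]

lemma aux_symm_adj {V : Type*} [NormedAddCommGroup V] [NormedSpace ℝ V] (G : V → ℝ) :
    ∀ (n : ℕ), ContDiff ℝ ((n + 1 : ℕ)) G → ∀ (i : Fin n) (x : V) (v : Fin (n+1) → V),
      iteratedFDeriv ℝ (n+1) G x (v ∘ Equiv.swap i.castSucc i.succ)
        = iteratedFDeriv ℝ (n+1) G x v := by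
  intro n
  induction n with
  | zero => intro _ i; exact i.elim0
  | succ n ih =>
    intro hG i x v
    have hd : ∀ y, DifferentiableAt ℝ (iteratedFDeriv ℝ (n+1) G) y := fun y =>
      hG.differentiable_iteratedFDeriv (by exact_mod_cast Nat.lt_succ_self _) y
    have hd' : ∀ y, DifferentiableAt ℝ (iteratedFDeriv ℝ n G) y := fun y =>
      hG.differentiable_iteratedFDeriv (by exact_mod_cast (by omega : n < n + 1 + 1)) y
    refine Fin.cases ?_ (fun j => ?_) i
    · set w : Fin n → V := fun j => v j.succ.succ with hw
      have hH : ContDiff ℝ 2 (fun y => iteratedFDeriv ℝ n G y w) := by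
        have h0 : ContDiff ℝ 2 (iteratedFDeriv ℝ n G) :=
          hG.iteratedFDeriv_right (by norm_cast; omega)
        exact (ContinuousMultilinearMap.apply ℝ (fun _ : Fin n => V) ℝ w).contDiff.comp h0
      have key : ∀ u : Fin (n+1+1) → V, (fun j => u j.succ.succ) = w →
          iteratedFDeriv ℝ (n+1+1) G x u =
          fderiv ℝ (fderiv ℝ (fun y => iteratedFDeriv ℝ n G y w)) x (u 0) (u 1) := by
        intro u hu
        rw [(hd x).iteratedFDeriv_succ_apply_left']
        have : (fun y => iteratedFDeriv ℝ (n+1) G y (Fin.tail u)) =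
            fun y => fderiv ℝ (fun y => iteratedFDeriv ℝ n G y w) y (u 1) := by
          funext y
          rw [(hd' y).iteratedFDeriv_succ_apply_left', ← hu]
          rfl
        rw [this]
        have hdd : DifferentiableAt ℝ (fderiv ℝ (fun y => iteratedFDeriv ℝ n G y w)) x :=
          ((hH.fderiv_right (m := 1) (by norm_num)).differentiable (by norm_num)) x
        rw [fderiv_clm_apply hdd (by fun_prop)]
        simp
      have hsymm : IsSymmSndFDerivAt ℝ (fun y => iteratedFDeriv ℝ n G y w) x :=
        hH.contDiffAt.isSymmSndFDerivAt (by simp)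
      rw [key v rfl, key]
      · have a0 : (v ∘ Equiv.swap (Fin.castSucc (0 : Fin (n+1))) (Fin.succ 0)) 0 = v 1 := by
          simp
        have a1 : (v ∘ Equiv.swap (Fin.castSucc (0 : Fin (n+1))) (Fin.succ 0)) 1 = v 0 := by
          simp
        rw [a0, a1]
        exact hsymm _ _
      · funext j
        simp only [hw, Function.comp]
        rw [Equiv.swap_apply_of_ne_of_ne]
        · simp [Fin.ext_iff]
        · simp [Fin.ext_iff]
    · rw [(hd x).iteratedFDeriv_succ_apply_left', (hd x).iteratedFDeriv_succ_apply_left']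
      have h0 : (v ∘ Equiv.swap j.succ.castSucc j.succ.succ) 0 = v 0 := by
        simp only [Function.comp]
        rw [Equiv.swap_apply_of_ne_of_ne]
        · simp [Fin.ext_iff]
        · simp [Fin.ext_iff]
      have h1 : Fin.tail (v ∘ Equiv.swap j.succ.castSucc j.succ.succ) =
          Fin.tail v ∘ Equiv.swap j.castSucc j.succ := by
        funext a
        simp only [Fin.tail, Function.comp]
        congr 1
        rw [← Fin.succ_castSucc]
        exact (Function.Injective.map_swap (Fin.succ_injective _) _ _ _).symm
      rw [h0, h1]
      congr 2
      funext y
      exact ih (hG.of_le (by exact_mod_cast Nat.le_succ _)) j y _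

lemma aux_symm {V : Type*} [NormedAddCommGroup V] [NormedSpace ℝ V] (G : V → ℝ)
    (n : ℕ) (hG : ContDiff ℝ n G) (x : V) (v : Fin n → V) (τ : Equiv.Perm (Fin n)) :
    iteratedFDeriv ℝ n G x (v ∘ τ) = iteratedFDeriv ℝ n G x v := by
  cases n with
  | zero => congr 1; funext i; exact i.elim0
  | succ n =>
    have hτ : τ ∈ Submonoid.closure
        (Set.range fun i : Fin n => Equiv.swap i.castSucc i.succ) := by
      rw [Equiv.Perm.mclosure_swap_castSucc_succ]; trivial
    induction hτ using Submonoid.closure_induction generalizing v with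
    | mem σ h => obtain ⟨i, rfl⟩ := h; exact aux_symm_adj G n hG i x v
    | one => rfl
    | mul a b _ _ ha hb =>
      rw [Equiv.Perm.coe_mul, ← Function.comp_assoc, hb, ha]

lemma aux_fin {U : Set E} (hconv : Convex ℝ U) (n : ℕ) (F : E → ℝ) (f : E) (hf : f ∈ U)
    (hC : IsCnAt U F n f) {ι : Type*} [Fintype ι] (h : ι → E) (hh : ∀ i, h i ∈ adm U f) :
    ∃ M : MultilinearMap ℝ (fun _ : Fin n => (ι → ℝ)) ℝ,
      (∀ c : Fin n → ι → ℝ, (∀ i, ∑ j, c i j • h j ∈ adm U f) →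
        gD U F n f (fun i => ∑ j, c i j • h j) = M c) ∧
      ∀ c (τ : Equiv.Perm (Fin n)), M (c ∘ τ) = M c := by
  let e := Fintype.equivFin ι
  obtain ⟨G, hG, hGF⟩ := hC _ (h ∘ e.symm) (fun i => hh _)
  let φ : (Fin (Fintype.card ι) → ℝ) →ₗ[ℝ] E := Fintype.linearCombination ℝ (h ∘ e.symm)
  refine ⟨((iteratedFDeriv ℝ n G 0).toMultilinearMap.compLinearMap
    (fun _ => LinearMap.funLeft ℝ ℝ e.symm)).domDomCongr Fin.revPerm, ?_, ?_⟩
  · intro c hc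
    have hφ : ∀ i, φ (c i ∘ e.symm) = ∑ j, c i j • h j := by
      intro i
      simp only [φ, Fintype.linearCombination_apply, Function.comp]
      exact Equiv.sum_comp e.symm (fun j => c i j • h j)
    have := aux_key hconv F n f φ G hG (fun l hl => hGF l hl) n le_rfl 0 (by simpa using hf)
      (fun i => c i ∘ e.symm) (fun i => by rw [hφ]; simpa using hc i)
    simp only [hφ, map_zero, add_zero] at this
    rw [this]
    rfl
  · intro c τ
    have := aux_symm G n hG 0 (fun i => c i.rev ∘ e.symm) (Fin.revPerm * τ * Fin.revPerm)
    refine Eq.trans ?_ this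
    show iteratedFDeriv ℝ n G 0 _ = iteratedFDeriv ℝ n G 0 _
    congr 1
    funext i
    simp
    rfl

lemma aux_exists_basis.{u} {E : Type u} [AddCommGroup E] [Module ℝ E] (A : Set E) :
    ∃ (ι : Type u) (b : Module.Basis ι ℝ (Submodule.span ℝ A)), ∀ i, (b i : E) ∈ A := by
  have hs : ⊤ ≤ Submodule.span ℝ (((↑) : Submodule.span ℝ A → E) ⁻¹' A) := by
    rw [Submodule.span_span_coe_preimage]
  exact ⟨_, Module.Basis.ofSpan hs, fun i =>
    Module.Basis.ofSpan_subset hs (Set.mem_range_self i)⟩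

end Aux

/-- For `F : U → ℝ` which is `C^n` at `f ∈ U` (with `U` a nonempty
convex subset of a real vector space), the `n`-th Gâteaux derivative at `f` is
symmetric in its directions and extends uniquely to a multilinear functional on
`(span ℝ (Adm_U f))^n`. -/
theorem stmt5 {E : Type*} [AddCommGroup E] [Module ℝ E]
    (U : Set E) (hne : U.Nonempty) (hconv : Convex ℝ U)
    (n : ℕ) (F : E → ℝ) (f : E) (hf : f ∈ U) (hC : IsCnAt U F n f) :
    (∀ (g : Fin n → E), (∀ i, g i ∈ adm U f) → ∀ τ : Equiv.Perm (Fin n),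
        gD U F n f (g ∘ τ) = gD U F n f g) ∧
    (∃! L : MultilinearMap ℝ (fun _ : Fin n => ↥(Submodule.span ℝ (adm U f))) ℝ,
      ∀ (g : Fin n → E) (hg : ∀ i, g i ∈ adm U f),
        L (fun i => ⟨g i, Submodule.subset_span (hg i)⟩) = gD U F n f g) := by
  refine ⟨fun g hg τ => ?_, ?_⟩
  · obtain ⟨M, hM, hsym⟩ := aux_fin hconv n F f hf hC g hg
    have h1 := hM (fun i => Pi.single i 1) (fun i => by simpa [Pi.single_apply] using hg i)
    have h2 := hM ((fun i => Pi.single i 1) ∘ τ)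
      (fun i => by simpa [Pi.single_apply] using hg (τ i))
    rw [hsym, ← h1] at h2
    simpa [Pi.single_apply, Function.comp_def] using h2
  · obtain ⟨ι, b, hb⟩ := aux_exists_basis (adm U f)
    let L : MultilinearMap ℝ (fun _ : Fin n => ↥(Submodule.span ℝ (adm U f))) ℝ :=
      ((Basis.piTensorProduct (fun _ : Fin n => b)).constr ℝ
        (fun p => gD U F n f (fun i => (b (p i) : E)))).compMultilinearMap
        (PiTensorProduct.tprod ℝ)
    have hL : ∀ p : Fin n → ι, L (fun i => b (p i)) = gD U F n f (fun i => (b (p i) : E)) := by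
      intro p
      simp only [L, LinearMap.compMultilinearMap_apply]
      rw [← Basis.piTensorProduct_apply (fun _ : Fin n => b) p, Module.Basis.constr_basis]
    refine ⟨L, ?_, ?_⟩
    · intro g hg
      let x : Fin n → ↥(Submodule.span ℝ (adm U f)) :=
        fun i => ⟨g i, Submodule.subset_span (hg i)⟩
      let S : Finset ι := Finset.univ.biUnion fun i => (b.repr (x i)).support
      obtain ⟨M, hM, -⟩ := aux_fin hconv n F f hf hC (fun s : S => (b s : E)) (fun s => hb s)
      let ψ : (S → ℝ) →ₗ[ℝ] ↥(Submodule.span ℝ (adm U f)) :=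
        Fintype.linearCombination ℝ (fun s : S => b s)
      have hψ : ∀ c : S → ℝ, (ψ c : E) = ∑ s, c s • (b s : E) := by
        intro c
        simp [ψ, Fintype.linearCombination_apply]
      have hML : L.compLinearMap (fun _ => ψ) = M := by
        refine Module.Basis.ext_multilinear (fun _ => Pi.basisFun ℝ S) fun p => ?_
        have h1 := hM (fun i => Pi.single (p i) 1)
          (fun i => by simpa [Pi.single_apply] using hb (p i))
        simp only [MultilinearMap.compLinearMap_apply, Pi.basisFun_apply]
        rw [← h1]
        have h2 : ∀ i, ψ (Pi.single (p i) 1) = b (p i) := by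
          intro i
          simp [ψ]
        simp only [h2, hL]
        congr 1
        funext i
        simp [Pi.single_apply]
      have hx : ∀ i, ψ (fun s => b.repr (x i) s) = x i := by
        intro i
        simp only [ψ, Fintype.linearCombination_apply]
        rw [Finset.sum_coe_sort S (fun s => b.repr (x i) s • b s)]
        conv_rhs => rw [← b.linearCombination_repr (x i), Finsupp.linearCombination_apply]
        rw [Finsupp.sum_of_support_subset]
        · exact Finset.subset_biUnion_of_mem (fun i => (b.repr (x i)).support)
            (Finset.mem_univ i)
        · simp
      have hxg : ∀ i, ∑ s : S, b.repr (x i) s • (b s : E) = g i := by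
        intro i
        rw [← hψ, hx]
      have h3 := hM (fun i s => b.repr (x i) s) (fun i => by rw [hxg]; exact hg i)
      simp only [hxg] at h3
      rw [h3, ← hML]
      simp only [MultilinearMap.compLinearMap_apply, hx]
      rfl
    · intro L' hL'
      refine Module.Basis.ext_multilinear (fun _ => b) fun p => ?_
      rw [hL, ← hL' _ (fun i => hb (p i))]
end

section
/- If F : W → ℝ is a C^n class function for some integer n > 0, then the functional Λ(g₁, …, g_n) := d^nF(0; g₁, …, g_n) on W^n is: (a) symmetric, i.e. invariant under permutation of the arguments g₁,…,g_n; (b) S_{[0,1]}-invariant, i.e. Λ(g₁^σ, …, g_n^σ) = Λ(g₁, …, g_n) for every invertible Lebesgue-measure-preserving bijection σ of [0,1], where g^σ(x,y) := g(σ(x),σ(y)); and (c) multilinear, i.e. it extends to a multilinear functional on (span_ℝ W)^n. -/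
open MeasureTheory Filter Set Topology
open scoped BigOperators Classical ENNReal

section Stmt8Helpers

/-- Adjacent transpositions of the arguments do not change the iterated derivative. -/
theorem iteratedFDeriv_swap_aux {E : Type*} [NormedAddCommGroup E] [NormedSpace ℝ E]
    {G : E → ℝ} : ∀ (n : ℕ), ContDiff ℝ ((n + 1 : ℕ) : ℕ∞) G → ∀ (i : Fin n) (x : E)
      (v : Fin (n + 1) → E),
      iteratedFDeriv ℝ (n + 1) G x (v ∘ Equiv.swap i.castSucc i.succ)
        = iteratedFDeriv ℝ (n + 1) G x v := by
  intro n
  induction n with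
  | zero => intro _ i; exact i.elim0
  | succ n ih =>
    intro hG i x v
    have hd : Differentiable ℝ (iteratedFDeriv ℝ (n + 1) G) :=
      hG.differentiable_iteratedFDeriv (by exact_mod_cast Nat.lt_succ_self (n + 1))
    have hd0 : Differentiable ℝ (iteratedFDeriv ℝ n G) :=
      hG.differentiable_iteratedFDeriv (by exact_mod_cast (by omega : n < n + 1 + 1))
    -- pointwise description of the outermost derivative
    have key : ∀ (w : Fin (n + 1) → E) (d : E),
        fderiv ℝ (iteratedFDeriv ℝ (n + 1) G) x d w
          = fderiv ℝ (fun y => iteratedFDeriv ℝ (n + 1) G y w) x d := by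
      intro w d
      have h1 := (hd x).hasFDerivAt
      have h2 := (ContinuousMultilinearMap.apply ℝ (fun _ : Fin (n + 1) => E) ℝ w).hasFDerivAt.comp
        x h1
      have h3 : fderiv ℝ (fun y => iteratedFDeriv ℝ (n + 1) G y w) x = _ := h2.fderiv
      rw [h3]; rfl
    cases i using Fin.cases with
    | zero =>
      have hs : IsSymmSndFDerivAt ℝ (iteratedFDeriv ℝ n G) x := by
        have hc : ContDiff ℝ 2 (iteratedFDeriv ℝ n G) :=
          hG.iteratedFDeriv_right (by
            rw [show n + 1 + 1 = 2 + n by omega]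
            push_cast
            rfl)
        exact hc.contDiffAt.isSymmSndFDerivAt (by simp)
      have key2 : ∀ w : Fin (n + 1 + 1) → E,
          iteratedFDeriv ℝ (n + 1 + 1) G x w
            = fderiv ℝ (fderiv ℝ (iteratedFDeriv ℝ n G)) x (w 0) (w 1)
                (Fin.tail (Fin.tail w)) := by
        intro w
        rw [iteratedFDeriv_succ_apply_left]
        rw [key]
        have hc : ContDiff ℝ 2 (iteratedFDeriv ℝ n G) :=
          hG.iteratedFDeriv_right (by
            rw [show n + 1 + 1 = 2 + n by omega]
            push_cast
            rfl)
        have hdd : DifferentiableAt ℝ (fderiv ℝ (iteratedFDeriv ℝ n G)) x :=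
          ((hc.fderiv_right (m := 1) (by norm_num)).differentiable (by norm_num)) x
        have h1 := hdd.hasFDerivAt.clm_apply (hasFDerivAt_const (w 1) x)
        have h2 := (ContinuousMultilinearMap.apply ℝ (fun _ : Fin n => E) ℝ
          (Fin.tail (Fin.tail w))).hasFDerivAt.comp x h1
        have h3 : fderiv ℝ (fun y => iteratedFDeriv ℝ (n + 1) G y (Fin.tail w)) x = _ := h2.fderiv
        rw [h3]
        simp
      rw [key2, key2]
      have e0 : (v ∘ Equiv.swap (Fin.castSucc 0) (Fin.succ 0)) 0 = v 1 := by
        simp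
      have e1 : (v ∘ Equiv.swap (Fin.castSucc 0) (Fin.succ 0)) 1 = v 0 := by
        simp
      have e2 : Fin.tail (Fin.tail (v ∘ Equiv.swap (Fin.castSucc (0 : Fin (n + 1))) (Fin.succ 0)))
          = Fin.tail (Fin.tail v) := by
        funext j
        simp only [Fin.tail, Function.comp]
        rw [Equiv.swap_apply_of_ne_of_ne]
        · simp [Fin.ext_iff]
        · simp [Fin.ext_iff]
      rw [e0, e1, e2, hs.eq]
    | succ i =>
      rw [iteratedFDeriv_succ_apply_left, iteratedFDeriv_succ_apply_left]
      have e0 : (v ∘ Equiv.swap (Fin.castSucc i.succ) (Fin.succ i.succ)) 0 = v 0 := by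
        simp only [Function.comp]
        rw [Equiv.swap_apply_of_ne_of_ne]
        · simp [Fin.ext_iff]
        · simp [Fin.ext_iff]
      have e1 : Fin.tail (v ∘ Equiv.swap (Fin.castSucc i.succ) (Fin.succ i.succ))
          = Fin.tail v ∘ Equiv.swap i.castSucc i.succ := by
        funext j
        simp only [Fin.tail, Function.comp]
        congr 1
        rw [(Fin.succ_injective (n + 1)).map_swap, Fin.succ_castSucc]
      rw [e0, e1, key, key]
      congr 2
      funext y
      exact ih (hG.of_le (by exact_mod_cast (by omega : n + 1 ≤ n + 1 + 1))) i y _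

/-- Symmetry of the `n`-th derivative of a `C^n` function. -/
theorem iteratedFDeriv_perm_aux {E : Type*} [NormedAddCommGroup E] [NormedSpace ℝ E]
    {G : E → ℝ} (n : ℕ) (hG : ContDiff ℝ (n : ℕ∞) G) (x : E) (τ : Equiv.Perm (Fin n))
    (v : Fin n → E) :
    iteratedFDeriv ℝ n G x (v ∘ τ) = iteratedFDeriv ℝ n G x v := by
  cases n with
  | zero => congr 1; funext i; exact i.elim0
  | succ n =>
    have hτ : τ ∈ Submonoid.closure
        (Set.range fun i : Fin n ↦ Equiv.swap i.castSucc i.succ) := by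
      rw [Equiv.Perm.mclosure_swap_castSucc_succ]; trivial
    induction hτ using Submonoid.closure_induction generalizing v with
    | mem s hs =>
      obtain ⟨i, rfl⟩ := hs
      exact iteratedFDeriv_swap_aux n hG i x v
    | one => rfl
    | mul a b _ _ ha hb =>
      have : v ∘ ⇑(a * b) = (v ∘ a) ∘ b := rfl
      rw [this, hb, ha]

/-- Computation of the iterated Gâteaux derivative through an extension. -/
theorem gD_eq_aux {n m : ℕ} {F : Kern → ℝ} {h : Fin m → Kern} {G : (Fin m → ℝ) → ℝ}
    (hG : ContDiff ℝ (n : ℕ∞) G)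
    (hF : ∀ lam : Fin m → ℝ, ∑ j, lam j • h j ∈ Graphons → G lam = F (∑ j, lam j • h j)) :
    ∀ (k : ℕ), k ≤ n → ∀ (c : Fin k → Fin m → ℝ), (∀ i, ∑ j, c i j • h j ∈ Graphons) →
      ∀ lam : Fin m → ℝ, ∑ j, lam j • h j ∈ Graphons →
        (∃ ε : ℝ, 0 < ε ∧ ∀ x y, (∑ j, lam j • h j) x y ≤ 1 - ε) →
        gD Graphons F k (∑ j, lam j • h j) (fun i => ∑ j, c i j • h j)
          = iteratedFDeriv ℝ k G lam (c ∘ Fin.rev) := by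
  intro k
  induction k with
  | zero =>
    intro _ c _ lam hlam _
    simp [gD, hF lam hlam]
  | succ k ih =>
    intro hk c hc lam hlam ⟨ε, hε, hle⟩
    set d := c (Fin.last k) with hd
    set c' : Fin k → Fin m → ℝ := fun i => c i.castSucc with hc'
    have hadd : ∀ t : ℝ, (∑ j, lam j • h j) + t • (∑ j, d j • h j)
        = ∑ j, (lam + t • d) j • h j := by
      intro t
      simp [Finset.smul_sum, add_smul, Finset.sum_add_distrib, smul_smul]
    have hdG : (∑ j, d j • h j) ∈ Graphons := hc _
    have hdiff : DifferentiableAt ℝ (iteratedFDeriv ℝ k G) lam :=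
      hG.differentiable_iteratedFDeriv (by exact_mod_cast hk) lam
    have hder : HasDerivAt (fun t : ℝ => iteratedFDeriv ℝ k G (lam + t • d) (c' ∘ Fin.rev))
        (iteratedFDeriv ℝ (k + 1) G lam (c ∘ Fin.rev)) 0 := by
      have h1 : HasDerivAt (fun t : ℝ => lam + t • d) d 0 := by
        simpa using ((hasDerivAt_id (0 : ℝ)).smul_const d).const_add lam
      have h2 : HasFDerivAt (iteratedFDeriv ℝ k G) (fderiv ℝ (iteratedFDeriv ℝ k G) lam)
          (lam + (0 : ℝ) • d) := by
        simpa using hdiff.hasFDerivAt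
      have h3 := h2.comp_hasDerivAt (0 : ℝ) h1
      have h4 := (ContinuousMultilinearMap.apply ℝ (fun _ : Fin k => Fin m → ℝ) ℝ
        (c' ∘ Fin.rev)).hasFDerivAt.comp_hasDerivAt (0 : ℝ) h3
      have h5 : iteratedFDeriv ℝ (k + 1) G lam (c ∘ Fin.rev)
          = fderiv ℝ (iteratedFDeriv ℝ k G) lam d (c' ∘ Fin.rev) := by
        rw [iteratedFDeriv_succ_apply_left]
        have ha : (c ∘ Fin.rev) 0 = d := by
          simp [hd]
        have hb : Fin.tail (c ∘ Fin.rev) = c' ∘ Fin.rev := by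
          funext i
          simp [Fin.tail, hc', Fin.rev_succ]
        rw [ha, hb]
      rw [h5]
      exact h4
    have hbase : gD Graphons F k (∑ j, lam j • h j) (fun i => ∑ j, c' i j • h j)
        = iteratedFDeriv ℝ k G lam (c' ∘ Fin.rev) :=
      ih (by omega) c' (fun i => hc _) lam hlam ⟨ε, hε, hle⟩
    have hslope := hder.tendsto_slope_zero
    set A : Set ℝ := {t : ℝ | t ≠ 0 ∧ (∑ j, lam j • h j) + t • (∑ j, d j • h j) ∈ Graphons} with hA
    have hsub : Set.Ioo 0 ε ⊆ A := by
      intro t ht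
      refine ⟨ht.1.ne', ⟨?_, ?_⟩, ?_⟩
      · have := hlam.1.1.add (hdG.1.1.const_smul t)
        exact this
      · intro x y
        have e1 := hlam.1.2 x y
        have e2 := hdG.1.2 x y
        show (∑ j, lam j • h j) x y + t • (∑ j, d j • h j) x y
          = (∑ j, lam j • h j) y x + t • (∑ j, d j • h j) y x
        rw [e1, e2]
      · intro x y
        show (∑ j, lam j • h j) x y + t • (∑ j, d j • h j) x y ∈ Set.Icc (0 : ℝ) 1
        have e1 := (hlam.2 x y).1
        have e2 := hdG.2 x y
        have e3 := hle x y
        have e4 := ht.1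
        have e5 := ht.2
        simp only [smul_eq_mul]
        constructor
        · have := mul_nonneg e4.le e2.1
          linarith
        · have : t * (∑ j, d j • h j) x y ≤ t * 1 := mul_le_mul_of_nonneg_left e2.2 e4.le
          linarith
    have hne : NeBot (nhdsWithin (0 : ℝ) A) := by
      have h0 : NeBot (nhdsWithin (0 : ℝ) (Set.Ioo 0 ε)) := by
        rw [nhdsWithin_Ioo_eq_nhdsGT hε]; infer_instance
      exact h0.mono (nhdsWithin_mono _ hsub)
    have hlim : Tendsto (fun t : ℝ =>
        (gD Graphons F k ((∑ j, lam j • h j) + t • (∑ j, d j • h j))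
            (fun i => ∑ j, c' i j • h j)
          - gD Graphons F k (∑ j, lam j • h j) (fun i => ∑ j, c' i j • h j)) / t)
        (nhdsWithin 0 A) (nhds (iteratedFDeriv ℝ (k + 1) G lam (c ∘ Fin.rev))) := by
      have hmono : nhdsWithin (0 : ℝ) A ≤ nhdsWithin 0 {0}ᶜ :=
        nhdsWithin_mono _ (fun t ht => ht.1)
      refine (hslope.mono_left hmono).congr' ?_
      have hsmall : ∀ᶠ t : ℝ in nhdsWithin 0 A, |t| < ε / 2 := by
        apply mem_nhdsWithin_of_mem_nhds
        have := Metric.ball_mem_nhds (0 : ℝ) (half_pos hε)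
        filter_upwards [this] with t ht
        simpa using ht
      filter_upwards [hsmall, self_mem_nhdsWithin] with t ht htA
      rw [hbase, hadd t]
      have hmem := htA.2
      rw [hadd t] at hmem
      rw [ih (by omega) c' (fun i => hc _) (lam + t • d) hmem ⟨ε / 2, half_pos hε, ?_⟩]
      · simp only [zero_add, zero_smul, add_zero, smul_eq_mul]
        rw [div_eq_inv_mul]
      · intro x y
        rw [← hadd t]
        show (∑ j, lam j • h j) x y + t • (∑ j, d j • h j) x y ≤ _
        have e2 := hdG.2 x y
        have e3 := hle x y
        have e4 : t * (∑ j, d j • h j) x y ≤ |t| * 1 :=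
          (mul_le_mul_of_nonneg_right (le_abs_self t) e2.1).trans
            (mul_le_mul_of_nonneg_left e2.2 (abs_nonneg t))
        simp only [smul_eq_mul]
        linarith
    exact hlim.limUnder_eq

theorem zero_mem_graphons : (0 : Kern) ∈ Graphons := by
  refine ⟨⟨measurable_const, fun _ _ => rfl⟩, fun x y => ?_⟩
  simp

/-- The `n`-th Gâteaux derivative at `0` through an extension. -/
theorem gD_zero_eq {n m : ℕ} {F : Kern → ℝ} {h : Fin m → Kern} {G : (Fin m → ℝ) → ℝ}
    (hG : ContDiff ℝ (n : ℕ∞) G)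
    (hF : ∀ lam : Fin m → ℝ, ∑ j, lam j • h j ∈ Graphons → G lam = F (∑ j, lam j • h j))
    (c : Fin n → Fin m → ℝ) (g : Fin n → Kern) (hg : ∀ i, g i ∈ Graphons)
    (hcg : ∀ i, ∑ j, c i j • h j = g i) :
    gD Graphons F n 0 g = iteratedFDeriv ℝ n G 0 c := by
  have h0 : ∑ j, (0 : Fin m → ℝ) j • h j = 0 := by simp
  have := gD_eq_aux hG hF n le_rfl c (fun i => by rw [hcg]; exact hg i) 0
    (by rw [h0]; exact zero_mem_graphons) ⟨1, one_pos, fun x y => by rw [h0]; simp⟩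
  rw [h0] at this
  simp only [hcg] at this
  rw [this]
  exact iteratedFDeriv_perm_aux n hG 0 Fin.revPerm c

/-- Existence of the extension at `0` for graphon directions. -/
theorem exists_ext_zero {n m : ℕ} {F : Kern → ℝ} (hC : IsCn Graphons F n)
    (h : Fin m → Kern) (hh : ∀ j, h j ∈ Graphons) :
    ∃ G : (Fin m → ℝ) → ℝ, ContDiff ℝ (n : ℕ∞) G ∧
      ∀ lam : Fin m → ℝ, ∑ j, lam j • h j ∈ Graphons → G lam = F (∑ j, lam j • h j) := by
  obtain ⟨G, hG, hF⟩ := hC 0 zero_mem_graphons m h (fun i => by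
    refine ⟨1, one_pos, le_rfl, fun ε h0 h1 => ?_⟩
    rw [zero_add]
    obtain ⟨⟨hm, hs⟩, hb⟩ := hh i
    refine ⟨⟨hm.const_smul ε, fun x y => ?_⟩, fun x y => ?_⟩
    · show ε • h i x y = ε • h i y x
      rw [hs]
    · show ε • h i x y ∈ _
      exact ⟨mul_nonneg h0 (hb x y).1, mul_le_one₀ h1.le (hb x y).1 (hb x y).2⟩)
  refine ⟨G, hG, fun lam hl => ?_⟩
  have := hF lam (by rwa [zero_add])
  rwa [zero_add] at this

theorem sum_single_smul {n : ℕ} (g : Fin n → Kern) (i : Fin n) :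
    ∑ j, (Pi.single i (1 : ℝ) : Fin n → ℝ) j • g j = g i := by
  rw [Finset.sum_eq_single i]
  · simp
  · intro b _ hb; simp [hb]
  · simp

theorem translate_mem {σ : ℝ → ℝ} (hσ : IsMPB σ) {g : Kern} (hg : g ∈ Graphons) :
    Kern.translate σ g ∈ Graphons := by
  obtain ⟨⟨hm, hs⟩, hb⟩ := hg
  have hmσ := hσ.1.measurable
  exact ⟨⟨hm.comp ((hmσ.comp measurable_fst).prodMk (hmσ.comp measurable_snd)),
    fun x y => hs _ _⟩, fun x y => hb _ _⟩

theorem homDensity_translate {σ : ℝ → ℝ} (hσ : IsMPB σ) {g : Kern} (hg : g ∈ Graphons) (H : MG) :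
    homDensity H (Kern.translate σ g) = homDensity H g := by
  have hp : MeasurePreserving (fun (x : Fin H.nv → ℝ) i => σ (x i))
      (Measure.pi fun _ => μ01) (Measure.pi fun _ => μ01) :=
    measurePreserving_pi _ _ (fun _ => hσ.1)
  unfold homDensity
  conv_rhs => rw [← hp.map_eq]
  rw [integral_map hp.measurable.aemeasurable]
  · rfl
  · apply Measurable.aestronglyMeasurable
    apply Finset.measurable_prod
    intro e _
    have hm : Measurable (fun x : Fin H.nv → ℝ => (x (H.s e), x (H.t e))) :=
      (measurable_pi_apply _).prodMk (measurable_pi_apply _)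
    exact hg.1.1.comp hm

theorem gD_translate {n : ℕ} {F : Kern → ℝ} (hclass : IsClassFun F)
    (hC : IsCn Graphons F n) (g : Fin n → Kern) (hg : ∀ i, g i ∈ Graphons) (σ : ℝ → ℝ)
    (hσ : IsMPB σ) :
    gD Graphons F n 0 (fun i => Kern.translate σ (g i)) = gD Graphons F n 0 g := by
  obtain ⟨G, hG, hF⟩ := exists_ext_zero hC g hg
  have hgσ : ∀ i, Kern.translate σ (g i) ∈ Graphons := fun i => translate_mem hσ (hg i)
  obtain ⟨G', hG', hF'⟩ := exists_ext_zero hC (fun i => Kern.translate σ (g i)) hgσ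
  rw [gD_zero_eq hG hF _ g hg (sum_single_smul g),
    gD_zero_eq hG' hF' _ _ hgσ (sum_single_smul _)]
  rcases Nat.eq_zero_or_pos n with rfl | hn
  · have : (∑ j, (0 : Fin 0 → ℝ) j • g j) ∈ Graphons := by simpa using zero_mem_graphons
    have h1 := hF 0 this
    have h2 := hF' 0 (by simpa using zero_mem_graphons)
    simp at h1 h2
    simp [h1, h2]
  have hn' : (0 : ℝ) < n := by exact_mod_cast hn
  set S : Set (Fin n → ℝ) := Set.pi Set.univ (fun _ => Set.Icc (0 : ℝ) (1 / n)) with hS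
  have hu : UniqueDiffOn ℝ S :=
    UniqueDiffOn.univ_pi (fun _ => uniqueDiffOn_Icc (by positivity))
  have h0 : (0 : Fin n → ℝ) ∈ S := fun i _ => ⟨le_rfl, by simp⟩
  have heq : Set.EqOn G' G S := by
    intro lam hl
    have hl' : ∀ i, 0 ≤ lam i ∧ lam i ≤ 1 / n := fun i => hl i trivial
    have happ : ∀ x y, (∑ j, lam j • g j) x y = ∑ j, lam j * g j x y := by
      intro x y; simp [Finset.sum_apply]
    have hmem : ∑ j, lam j • g j ∈ Graphons := by
      refine ⟨⟨?_, ?_⟩, ?_⟩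
      · have : Function.uncurry (∑ j, lam j • g j)
            = fun p => ∑ j, lam j * Function.uncurry (g j) p := by
          funext p; exact happ p.1 p.2
        rw [this]
        exact Finset.measurable_sum _ (fun j _ => (hg j).1.1.const_mul _)
      · intro x y
        rw [happ, happ]
        exact Finset.sum_congr rfl (fun j _ => by rw [(hg j).1.2 x y])
      · intro x y
        rw [happ]
        constructor
        · exact Finset.sum_nonneg (fun j _ => mul_nonneg (hl' j).1 ((hg j).2 x y).1)
        · calc ∑ j, lam j * g j x y ≤ ∑ j : Fin n, (1 / n : ℝ) :=
                Finset.sum_le_sum (fun j _ =>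
                  (mul_le_of_le_one_right (hl' j).1 ((hg j).2 x y).2).trans (hl' j).2)
            _ = 1 := by simp [hn'.ne']
    have htr : ∑ j, lam j • Kern.translate σ (g j) = Kern.translate σ (∑ j, lam j • g j) := by
      funext x y
      simp [Kern.translate, Finset.sum_apply]
    have hmem' := translate_mem hσ hmem
    rw [hF lam hmem, hF' lam (by rw [htr]; exact hmem'), htr]
    exact hclass _ _ hmem' hmem (fun H _ => homDensity_translate hσ hmem H)
  rw [← iteratedFDerivWithin_eq_iteratedFDeriv hu hG.contDiffAt h0,
    ← iteratedFDerivWithin_eq_iteratedFDeriv hu hG'.contDiffAt h0,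
    iteratedFDerivWithin_congr heq h0]

/-- A multilinear map with prescribed values on tuples of basis vectors. -/
theorem exists_multilinear_basis {ι V : Type*} [AddCommGroup V] [Module ℝ V]
    (b : Module.Basis ι ℝ V) : ∀ (n : ℕ) (Λ : (Fin n → ι) → ℝ),
    ∃ L : MultilinearMap ℝ (fun _ : Fin n => V) ℝ, ∀ j, L (fun i => b (j i)) = Λ j := by
  intro n
  induction n with
  | zero =>
    intro Λ
    refine ⟨MultilinearMap.constOfIsEmpty ℝ _ (Λ Fin.elim0), fun j => ?_⟩
    rw [MultilinearMap.constOfIsEmpty_apply]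
    exact congrArg Λ (funext fun i => i.elim0)
  | succ n ih =>
    intro Λ
    choose L hL using fun a : ι => ih (fun j => Λ (Fin.cons a j))
    refine ⟨LinearMap.uncurryLeft (M := fun _ : Fin (n + 1) => V) (b.constr ℝ L), fun j => ?_⟩
    rw [LinearMap.uncurryLeft_apply]
    rw [Module.Basis.constr_basis]
    have := hL (j 0) (Fin.tail j)
    rw [Fin.cons_self_tail] at this
    exact this

theorem gD_multilinear {n : ℕ} {F : Kern → ℝ} (hC : IsCn Graphons F n) :
    IsMultilinearOnW n (fun g => gD Graphons F n 0 g) := by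
  set V := Submodule.span ℝ Graphons with hV
  set s : Set V := {v | (v : Kern) ∈ Graphons} with hs
  have hspan : ⊤ ≤ Submodule.span ℝ s := by
    have : Submodule.span ℝ ((Subtype.val : V → Kern) ⁻¹' Graphons) = ⊤ :=
      Submodule.span_span_coe_preimage
    exact this.ge
  set b := Module.Basis.ofSpan hspan with hb
  have hbG : ∀ i, ((b i : V) : Kern) ∈ Graphons := fun i =>
    Module.Basis.ofSpan_subset hspan ⟨i, rfl⟩
  obtain ⟨L, hL⟩ := exists_multilinear_basis b n
    (fun j => gD Graphons F n 0 (fun i => ((b (j i) : V) : Kern)))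
  refine ⟨L, fun g hg => ?_⟩
  set v : Fin n → V := fun i => ⟨g i, Submodule.subset_span (hg i)⟩ with hv
  set T := Finset.univ.biUnion (fun i => (b.repr (v i)).support) with hT
  set e := T.equivFin with he
  set u : Fin T.card → V := fun k => b (e.symm k) with hu
  set c : Fin n → Fin T.card → ℝ := fun i k => b.repr (v i) (e.symm k) with hc
  have hcu : ∀ i, ∑ k, c i k • u k = v i := by
    intro i
    conv_rhs => rw [← b.linearCombination_repr (v i)]
    rw [Finsupp.linearCombination_apply, Finsupp.sum_of_support_subset _ (s := T)]
    · rw [← Finset.sum_coe_sort T]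
      exact Equiv.sum_comp e.symm (fun t : T => b.repr (v i) t • b t)
    · exact Finset.subset_biUnion_of_mem (fun i => (b.repr (v i)).support) (Finset.mem_univ i)
    · intro t _; simp
  obtain ⟨G, hG, hF⟩ := exists_ext_zero hC (fun k => (u k : Kern)) (fun k => hbG _)
  have hM : L.compLinearMap (fun _ => Fintype.linearCombination ℝ u)
      = (iteratedFDeriv ℝ n G 0).toMultilinearMap := by
    refine Module.Basis.ext_multilinear (fun _ => Pi.basisFun ℝ (Fin T.card)) (fun j => ?_)
    have h1 := gD_zero_eq hG hF (fun i => Pi.single (j i) (1 : ℝ))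
      (fun i => (u (j i) : Kern)) (fun i => hbG _) (fun i => sum_single_smul _ (j i))
    simp only [MultilinearMap.compLinearMap_apply, Pi.basisFun_apply,
      Fintype.linearCombination_apply_single, one_smul]
    rw [hL (fun i => e.symm (j i))]
    exact h1
  have h2 := gD_zero_eq hG hF c g hg (fun i => by
    have := congrArg (Subtype.val) (hcu i)
    simpa using this)
  have h3 := congrArg (fun M => M c) hM
  simp only [MultilinearMap.compLinearMap_apply, Fintype.linearCombination_apply, hcu] at h3
  exact h3.trans h2.symm

end Stmt8Helpers

/-- For a `C^n` class function `F : W → ℝ` (`n > 0`), the functional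
`Λ(g₁,…,g_n) := d^nF(0; g₁,…,g_n)` on `W^n` is (a) symmetric, (b) invariant under
measure-preserving bijections of `[0,1]`, and (c) multilinear, i.e. it extends to a
multilinear functional on `(span ℝ W)^n`. -/
theorem stmt8 (n : ℕ) (hn : 0 < n) (F : Kern → ℝ) (hclass : IsClassFun F)
    (hC : IsCn Graphons F n) :
    (∀ (g : Fin n → Kern), (∀ i, g i ∈ Graphons) → ∀ τ : Equiv.Perm (Fin n),
        gD Graphons F n 0 (g ∘ τ) = gD Graphons F n 0 g) ∧
    (∀ (g : Fin n → Kern), (∀ i, g i ∈ Graphons) → ∀ σ : ℝ → ℝ, IsMPB σ →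
        gD Graphons F n 0 (fun i => Kern.translate σ (g i)) = gD Graphons F n 0 g) ∧
    IsMultilinearOnW n (fun g => gD Graphons F n 0 g) := by
  refine ⟨fun g hg τ => ?_, fun g hg σ hσ => gD_translate hclass hC g hg σ hσ, gD_multilinear hC⟩
  obtain ⟨G, hG, hF⟩ := exists_ext_zero hC g hg
  rw [gD_zero_eq hG hF _ g hg (sum_single_smul g),
    gD_zero_eq hG hF (fun i => Pi.single (τ i) 1) (g ∘ τ) (fun i => hg _)
      (fun i => sum_single_smul g (τ i))]
  exact iteratedFDeriv_perm_aux n hG 0 τ (fun i => Pi.single i (1 : ℝ))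
end

section
/- Fix integers n ≥ 1 and k ≥ 1. There exists a matrix π_{n,k} with nonnegative integer entries, indexed by pairs of isomorphism classes of multigraphs with n edges and no isolated vertices, such that for every p ≥ 2, every symmetric S_{[0,1]}-invariant multilinear functional Λ : W^n → ℝ, and every isomorphism class g of multigraphs with n edges on p vertices, C_{n,p}(Λ)(g) = Σ_h π_{n,k}(g̃, h̃)·C_{n,kp}(Λ)(h), where h ranges over isomorphism classes of multigraphs with n edges on kp vertices and g̃, h̃ denote the classes obtained by deleting isolated vertices. Moreover π_{n,k}(g̃, h̃) ≠ 0 only if some multigraph in h̃ admits a surjective node-and-edge homomorphism onto some multigraph in g̃, and π_{n,k}(g̃, g̃) > 0. -/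
open MeasureTheory Filter Set Topology
open scoped BigOperators Classical ENNReal

section Stmt9Aux

theorem aux_pair_eq {α : Type*} [DecidableEq α] (a b c d : α) :
    (({a, b} : Finset α) = {c, d}) ↔ s(a, b) = s(c, d) := by
  rw [← Finset.coe_inj]
  simp only [Finset.coe_pair, Set.pair_eq_pair_iff, Sym2.eq_iff]

/-- The edge as an unordered pair of naturals. -/
def auxEdge (G : MG) (e : Fin G.ne) : Sym2 ℕ := s((G.s e : ℕ), (G.t e : ℕ))

/-- Isomorphism after adding infinitely many isolated vertices. -/
def PE (G H : MG) : Prop :=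
  ∃ (τ : Fin G.ne ≃ Fin H.ne) (f : Equiv.Perm ℕ),
    ∀ e, (auxEdge G e).map f = auxEdge H (τ e)

theorem PE.symm {G H : MG} (h : PE G H) : PE H G := by
  obtain ⟨τ, f, h⟩ := h
  refine ⟨τ.symm, f.symm, fun e => ?_⟩
  have := h (τ.symm e)
  rw [Equiv.apply_symm_apply] at this
  rw [← this, Sym2.map_map]
  simp

theorem PE.trans {G H K : MG} (h : PE G H) (h' : PE H K) : PE G K := by
  obtain ⟨τ, f, h⟩ := h
  obtain ⟨τ', f', h'⟩ := h'
  refine ⟨τ.trans τ', f.trans f', fun e => ?_⟩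
  rw [Equiv.trans_apply, ← h', ← h, Sym2.map_map]
  rfl

theorem PE_of_inj {G H : MG} (τ : Fin G.ne ≃ Fin H.ne) (f : Fin G.nv → ℕ)
    (hf : Function.Injective f)
    (h : ∀ e, s(f (G.s e), f (G.t e)) = auxEdge H (τ e)) : PE G H := by
  obtain ⟨g, hg⟩ := (MulAction.isMultiplyPretransitive_iff (G := Equiv.Perm ℕ) (α := ℕ)
    (n := G.nv)).1 (Equiv.Perm.isMultiplyPretransitive ℕ G.nv) Fin.valEmbedding ⟨f, hf⟩
  have hg' : ∀ i : Fin G.nv, g (i : ℕ) = f i := fun i => by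
    have := DFunLike.congr_fun hg i
    simpa using this
  refine ⟨τ, g, fun e => ?_⟩
  rw [← h e, auxEdge, Sym2.map_mk, hg', hg']

theorem PE_of_MGIso {G H : MG} (h : MGIso G H) : PE G H := by
  obtain ⟨φ, hv, he⟩ := h
  refine PE_of_inj (Equiv.ofBijective _ he) (fun v => φ.vMap v)
    (Fin.val_injective.comp hv.1) (fun e => ?_)
  have := (aux_pair_eq _ _ _ _).1 (φ.compat e)
  have h2 := congrArg (Sym2.map (Fin.val)) this
  simpa [auxEdge] using h2.symm

theorem PE_pad (G : MG) (a : ℕ) : PE G (G.pad a) :=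
  PE_of_inj (Equiv.refl _) (fun v => v) Fin.val_injective (fun _ => rfl)

theorem MGIso_of_PE {G H : MG} (h : PE G H) (hn : G.nv = H.nv) : MGIso G H := by
  obtain ⟨τ, f, h⟩ := h
  let S : Set (Fin G.nv) := {v | ∃ e, G.s e = v ∨ G.t e = v}
  have hlt : ∀ v : Fin G.nv, v ∈ S → f v < G.nv := by
    rintro v ⟨e, he⟩
    have h1 : f (v : ℕ) ∈ auxEdge H (τ e) := by
      rw [← h e, auxEdge, Sym2.map_mk]
      rcases he with rfl | rfl <;> simp
    rw [auxEdge, Sym2.mem_iff] at h1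
    rcases h1 with h1 | h1 <;> rw [h1] <;> exact lt_of_lt_of_eq (Fin.isLt _) hn.symm
  let g : S → Fin G.nv := fun v => ⟨f (v : Fin G.nv), hlt v v.2⟩
  have hg : Function.Injective g := by
    intro a b hab
    have := congrArg Fin.val hab
    exact Subtype.ext (Fin.ext (f.injective this))
  obtain ⟨ρ, hρ⟩ := Equiv.Perm.exists_extending_pair (fun v : S => (v : Fin G.nv)) g
    Subtype.val_injective hg
  have hρ' : ∀ v ∈ S, (ρ v : ℕ) = f v := fun v hv => by
    have := congrArg Fin.val (hρ ⟨v, hv⟩)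
    simpa [g] using this
  refine ⟨⟨fun v => finCongr hn (ρ v), τ, fun e => ?_⟩,
    ((ρ.trans (finCongr hn)).bijective), τ.bijective⟩
  rw [aux_pair_eq]
  apply Sym2.map.injective Fin.val_injective
  have h1 := h e
  simp only [auxEdge, Sym2.map_mk] at h1 ⊢
  rw [← h1, ← hρ' _ ⟨e, Or.inl rfl⟩, ← hρ' _ ⟨e, Or.inr rfl⟩]
  simp

theorem StripEquiv_iff (G H : MG) : StripEquiv G H ↔ PE G H := by
  constructor
  · rintro ⟨a, b, h⟩
    exact ((PE_pad G a).trans (PE_of_MGIso h)).trans (PE_pad H b).symm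
  · intro h
    refine ⟨H.nv, G.nv, MGIso_of_PE (((PE_pad G _).symm.trans h).trans (PE_pad H _)) ?_⟩
    simp [MG.pad, add_comm]

/-- vertex lift -/
def liftV {k N : ℕ} (v : Fin N) (j : Fin k) : Fin (k * N) :=
  ⟨v * k + j, by
    have h1 := v.isLt
    have h2 := j.isLt
    calc (v : ℕ) * k + j < v * k + k := by omega
      _ = k * (v + 1) := by ring
      _ ≤ k * N := Nat.mul_le_mul_left _ h1⟩

theorem liftV_inj {k N : ℕ} {v v' : Fin N} {j j' : Fin k} (h : liftV v j = liftV v' j') :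
    v = v' ∧ j = j' := by
  have h0 : (v : ℕ) * k + j = v' * k + j' := congrArg Fin.val h
  have hk : 0 < k := lt_of_le_of_lt (Nat.zero_le _) j.isLt
  have h1 : (v : ℕ) = v' := by
    have := congrArg (· / k) h0
    simpa [Nat.add_div_of_dvd_right, Nat.mul_div_cancel _ hk, Nat.div_eq_of_lt] using this
  refine ⟨Fin.ext h1, Fin.ext ?_⟩
  rw [h1] at h0
  omega

/-- The blow-up of a multigraph. -/
def blow (k : ℕ) (G : MG) (u : Fin G.ne → Fin k × Fin k) : MG where
  nv := k * G.nv
  ne := G.ne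
  s := fun e => liftV (G.s e) (u e).1
  t := fun e => liftV (G.t e) (u e).2
  noLoop := fun e h => G.noLoop e (liftV_inj h).1

/-- the matrix -/
noncomputable def piM (k : ℕ) (G H : MG) : ℕ :=
  (Finset.univ.filter (fun u : Fin G.ne → Fin k × Fin k => PE (blow k G u) H)).card

theorem piM_le {k : ℕ} (hk : 1 ≤ k) {G G' H H' : MG} (hG : PE G G') (hH : PE H H') :
    piM k G H ≤ piM k G' H' := by
  obtain ⟨τ, f, h⟩ := hG
  have : NeZero k := ⟨by omega⟩
  let F : Equiv.Perm ℕ := (Nat.divModEquiv k).trans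
    ((Equiv.prodCongr f (Equiv.refl _)).trans (Nat.divModEquiv k).symm)
  have hF : ∀ (v : ℕ) (j : Fin k), F (v * k + j) = f v * k + j := by
    intro v j
    have : v * k + (j : ℕ) = (Nat.divModEquiv k).symm (v, j) := rfl
    simp only [F, Equiv.trans_apply]
    rw [this, Equiv.apply_symm_apply]
    rfl
  let A : Fin G.ne → Prop := fun e => f (G.s e) = G'.s (τ e) ∧ f (G.t e) = G'.t (τ e)
  let T : (Fin G.ne → Fin k × Fin k) → (Fin G'.ne → Fin k × Fin k) := fun u e' =>
    if A (τ.symm e') then u (τ.symm e') else (u (τ.symm e')).swap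
  have hT : ∀ u e, T u (τ e) = if A e then u e else (u e).swap := by
    intro u e
    simp [T]
  refine Finset.card_le_card_of_injOn T ?_ ?_
  · intro u hu
    simp only [Finset.coe_filter, Finset.mem_univ, true_and, Set.mem_ofPred_eq] at hu ⊢
    have aux : ∀ e, Sym2.map F s((G.s e : ℕ) * k + ((u e).1 : ℕ), (G.t e : ℕ) * k + ((u e).2 : ℕ)) =
      s((G'.s (τ e) : ℕ) * k + ((T u (τ e)).1 : ℕ), (G'.t (τ e) : ℕ) * k + ((T u (τ e)).2 : ℕ)) := by
      intro e
      have he := h e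
      rw [Sym2.map_mk, hF, hF, hT]
      by_cases hA : A e
      · rw [if_pos hA, hA.1, hA.2]
      · rw [if_neg hA]
        simp only [auxEdge, Sym2.map_mk, Sym2.eq_iff] at he
        rcases he with he | he
        · exact absurd he hA
        · rw [he.1, he.2, Sym2.eq_swap]
          rfl
    have hb : PE (blow k G u) (blow k G' (T u)) := by
      refine ⟨τ, F, fun e => ?_⟩
      exact aux e
    exact hb.symm.trans (hu.trans hH)
  · intro u _ u' _ huu
    funext e
    have h1 : T u (τ e) = T u' (τ e) := by rw [huu]
    rw [hT, hT] at h1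
    split_ifs at h1
    · exact h1
    · exact Prod.swap_injective h1

theorem piM_congr {k : ℕ} (hk : 1 ≤ k) {G G' H H' : MG} (hG : PE G G') (hH : PE H H') :
    piM k G H = piM k G' H' :=
  le_antisymm (piM_le hk hG hH) (piM_le hk hG.symm hH.symm)

theorem piM_pos {k : ℕ} (hk : 1 ≤ k) (G : MG) : 0 < piM k G G := by
  rw [piM, Finset.card_pos]
  let u : Fin G.ne → Fin k × Fin k := fun _ => (⟨0, hk⟩, ⟨0, hk⟩)
  refine ⟨u, ?_⟩
  simp only [Finset.mem_filter, Finset.mem_univ, true_and]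
  refine PE.symm (PE_of_inj (Equiv.refl _) (fun v => (v : ℕ) * k) ?_ (fun _ => rfl))
  intro a b hab
  exact Fin.ext (Nat.eq_of_mul_eq_mul_right hk hab)

theorem exists_strip (G : MG) : ∃ (m : ℕ) (_ : Fin m ≃ {v : Fin G.nv // ∃ e, G.s e = v ∨ G.t e = v}),
    True := ⟨_, (Fintype.equivFin _).symm, trivial⟩

/-- deletion of isolated vertices -/
def strip (G : MG) (m : ℕ) (ι : Fin m ≃ {v : Fin G.nv // ∃ e, G.s e = v ∨ G.t e = v}) : MG where
  nv := m
  ne := G.ne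
  s := fun e => ι.symm ⟨G.s e, e, Or.inl rfl⟩
  t := fun e => ι.symm ⟨G.t e, e, Or.inr rfl⟩
  noLoop := fun e h => G.noLoop e (congrArg Subtype.val (ι.symm.injective h))

theorem strip_PE (G : MG) (m : ℕ)
    (ι : Fin m ≃ {v : Fin G.nv // ∃ e, G.s e = v ∨ G.t e = v}) : PE (strip G m ι) G := by
  refine PE_of_inj (Equiv.refl _) (fun v : Fin m => ((ι v : Fin G.nv) : ℕ)) ?_ (fun e => ?_)
  · intro a b hab
    exact ι.injective (Subtype.ext (Fin.ext hab))
  · change s(((ι (ι.symm ⟨G.s e, e, Or.inl rfl⟩) : Fin G.nv) : ℕ),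
      ((ι (ι.symm ⟨G.t e, e, Or.inr rfl⟩) : Fin G.nv) : ℕ)) = s((G.s e : ℕ), (G.t e : ℕ))
    rw [Equiv.apply_symm_apply, Equiv.apply_symm_apply]

theorem strip_noIsolated (G : MG) (m : ℕ)
    (ι : Fin m ≃ {v : Fin G.nv // ∃ e, G.s e = v ∨ G.t e = v}) : NoIsolated (strip G m ι) := by
  intro v
  obtain ⟨e, he⟩ := (ι v).2
  refine ⟨e, ?_⟩
  rcases he with he | he
  · exact Or.inl ((Equiv.symm_apply_eq _).2 (Subtype.ext he))
  · exact Or.inr ((Equiv.symm_apply_eq _).2 (Subtype.ext he))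

theorem surj_part {k : ℕ} (G H : MG) (h : piM k G H ≠ 0) :
    ∃ G' H' : MG, NoIsolated G' ∧ NoIsolated H' ∧
      StripEquiv G' G ∧ StripEquiv H' H ∧ ∃ φ : MGHom H' G', φ.Surj := by
  obtain ⟨u, hu⟩ := Finset.card_ne_zero.1 h
  simp only [Finset.mem_filter, Finset.mem_univ, true_and] at hu
  obtain ⟨m, ι, -⟩ := exists_strip G
  obtain ⟨m', ι', -⟩ := exists_strip (blow k G u)
  refine ⟨strip G m ι, strip (blow k G u) m' ι', strip_noIsolated _ _ _, strip_noIsolated _ _ _,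
    (StripEquiv_iff _ _).2 (strip_PE _ _ _),
    (StripEquiv_iff _ _).2 ((strip_PE _ _ _).trans hu), ?_⟩
  have hex : ∀ w : {v : Fin (blow k G u).nv // ∃ e, (blow k G u).s e = v ∨ (blow k G u).t e = v},
      ∃ v : {v : Fin G.nv // ∃ e, G.s e = v ∨ G.t e = v}, ∃ j : Fin k,
        w.val = liftV (v : Fin G.nv) j := by
    rintro ⟨w, e, he | he⟩
    · exact ⟨⟨G.s e, e, Or.inl rfl⟩, (u e).1, he.symm⟩
    · exact ⟨⟨G.t e, e, Or.inr rfl⟩, (u e).2, he.symm⟩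
  choose pr j hpr using hex
  have hs : ∀ e : Fin G.ne, pr ⟨(blow k G u).s e, e, Or.inl rfl⟩ = ⟨G.s e, e, Or.inl rfl⟩ := by
    intro e
    exact Subtype.ext (liftV_inj (hpr ⟨(blow k G u).s e, e, Or.inl rfl⟩)).1.symm
  have ht : ∀ e : Fin G.ne, pr ⟨(blow k G u).t e, e, Or.inr rfl⟩ = ⟨G.t e, e, Or.inr rfl⟩ := by
    intro e
    exact Subtype.ext (liftV_inj (hpr ⟨(blow k G u).t e, e, Or.inr rfl⟩)).1.symm
  have hS : ∀ e, ι.symm (pr (ι' ((strip (blow k G u) m' ι').s e))) = (strip G m ι).s e := by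
    intro e
    change ι.symm (pr (ι' (ι'.symm _))) = ι.symm _
    rw [Equiv.apply_symm_apply]
    exact congrArg ι.symm (hs e)
  have hT : ∀ e, ι.symm (pr (ι' ((strip (blow k G u) m' ι').t e))) = (strip G m ι).t e := by
    intro e
    change ι.symm (pr (ι' (ι'.symm _))) = ι.symm _
    rw [Equiv.apply_symm_apply]
    exact congrArg ι.symm (ht e)
  refine ⟨⟨fun v => ι.symm (pr (ι' v)), fun e => e, fun e => ?_⟩, ?_, fun e => ⟨e, rfl⟩⟩
  · exact (aux_pair_eq _ _ _ _).2 (by rw [hS e, hT e])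
  · intro v
    obtain ⟨e, he⟩ := strip_noIsolated G m ι v
    rcases he with he | he
    · exact ⟨_, (hS e).trans he⟩
    · exact ⟨_, (hT e).trans he⟩

theorem mem_cell_iff {q : ℕ} (hq : 0 < q) (a : Fin q) (x : ℝ) :
    x ∈ cell q a ↔ ⌈x * q⌉ = ((a : ℕ) : ℤ) + 1 := by
  have hq' : (0 : ℝ) < q := by exact_mod_cast hq
  rw [cell, Set.mem_Ioc, Int.ceil_eq_iff, div_lt_iff₀ hq', le_div_iff₀ hq']
  push_cast
  rw [add_sub_cancel_right]

theorem cell_unique {q : ℕ} {a b : Fin q} {x : ℝ} (ha : x ∈ cell q a) (hb : x ∈ cell q b) :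
    a = b := by
  have hq : 0 < q := lt_of_le_of_lt (Nat.zero_le _) a.isLt
  rw [mem_cell_iff hq] at ha hb
  apply Fin.ext
  omega

theorem measurableSet_cell (q : ℕ) (a : Fin q) : MeasurableSet (cell q a) := measurableSet_Ioc

theorem iUnion_cell {q : ℕ} (hq : 0 < q) : (⋃ a : Fin q, cell q a) = Set.Ioc (0 : ℝ) 1 := by
  have hq' : (0 : ℝ) < q := by exact_mod_cast hq
  ext x
  simp only [Set.mem_iUnion, mem_cell_iff hq, Set.mem_Ioc]
  constructor
  · rintro ⟨a, ha⟩
    rw [Int.ceil_eq_iff] at ha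
    push_cast at ha
    have h1 : ((a : ℕ) : ℝ) + 1 ≤ q := by exact_mod_cast a.isLt
    have h0 : (0 : ℝ) ≤ ((a : ℕ) : ℝ) := by positivity
    constructor
    · have : 0 < x * q := by linarith
      exact pos_of_mul_pos_left this hq'.le
    · have : x * q ≤ 1 * q := by linarith
      exact le_of_mul_le_mul_right this hq'
  · rintro ⟨h0, h1⟩
    have hc0 : 0 < ⌈x * q⌉ := Int.ceil_pos.2 (by positivity)
    have hc1 : ⌈x * q⌉ ≤ q := Int.ceil_le.2 (by push_cast; nlinarith)
    refine ⟨⟨(⌈x * q⌉ - 1).toNat, by omega⟩, ?_⟩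
    simp only
    omega

theorem cell_sub {k p : ℕ} (hk : 0 < k) (hp : 0 < p) (a : Fin p) (x : ℝ) :
    x ∈ cell p a ↔ ∃ j : Fin k, x ∈ cell (k * p) (liftV a j) := by
  have hk' : (0 : ℝ) < k := by exact_mod_cast hk
  simp only [mem_cell_iff hp, mem_cell_iff (Nat.mul_pos hk hp), liftV, Int.ceil_eq_iff]
  constructor
  · rintro ⟨h1, h2⟩
    push_cast at h1 h2
    have h3 : (((a : ℕ) : ℤ) * k : ℤ) < ⌈x * (k * p)⌉ := Int.lt_ceil.2 (by
      push_cast; nlinarith)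
    have h4 : ⌈x * (k * p)⌉ ≤ (((a : ℕ) : ℤ) * k + k : ℤ) := Int.ceil_le.2 (by
      push_cast; nlinarith)
    have h5 := Int.ceil_lt_add_one (x * (k * p))
    have h6 := Int.le_ceil (x * (k * p))
    obtain ⟨j, hj⟩ : ∃ j : ℕ, ⌈x * (k * p)⌉ = ((a : ℕ) : ℤ) * k + j + 1 :=
      ⟨(⌈x * (k * p)⌉ - ((a : ℕ) : ℤ) * k - 1).toNat, by omega⟩
    refine ⟨⟨j, by omega⟩, ?_⟩
    rw [hj] at h5 h6
    push_cast at h5 h6 ⊢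
    constructor <;> linarith
  · rintro ⟨j, h1, h2⟩
    have hj : ((j : ℕ) : ℝ) + 1 ≤ k := by exact_mod_cast j.isLt
    have hj0 : (0 : ℝ) ≤ ((j : ℕ) : ℝ) := by positivity
    push_cast at h1 h2 ⊢
    constructor
    · have : ((a : ℕ) : ℝ) * k < (x * p) * k := by linarith
      have := lt_of_mul_lt_mul_right this hk'.le
      linarith
    · have : (x * p) * k ≤ (((a : ℕ) : ℝ) + 1) * k := by linarith
      exact le_of_mul_le_mul_right this hk'

/-- indicator of a cell -/
noncomputable def ic (q : ℕ) (a : Fin q) (x : ℝ) : ℝ := if x ∈ cell q a then 1 else 0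

theorem ep_eq {q : ℕ} {a b : Fin q} (h : a ≠ b) (x y : ℝ) :
    ep q a b x y = ic q a x * ic q b y + ic q b x * ic q a y := by
  have h1 : ¬ (x ∈ cell q a ∧ x ∈ cell q b) := fun hh => h (cell_unique hh.1 hh.2)
  by_cases hxa : x ∈ cell q a <;> by_cases hxb : x ∈ cell q b <;>
    by_cases hya : y ∈ cell q a <;> by_cases hyb : y ∈ cell q b <;>
    simp_all [ep, ic]

theorem ic_sum {k p : ℕ} (hk : 0 < k) (hp : 0 < p) (a : Fin p) (x : ℝ) :
    ic p a x = ∑ j : Fin k, ic (k * p) (liftV a j) x := by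
  by_cases h : x ∈ cell p a
  · obtain ⟨j, hj⟩ := (cell_sub hk hp a x).1 h
    rw [Finset.sum_eq_single j]
    · simp [ic, h, hj]
    · intro i _ hi
      rw [ic, if_neg]
      intro hx
      exact hi (liftV_inj (cell_unique hx hj)).2
    · simp
  · rw [ic, if_neg h, Finset.sum_eq_zero]
    intro j _
    rw [ic, if_neg]
    exact fun hj => h ((cell_sub hk hp a x).2 ⟨j, hj⟩)

theorem ep_sum {k p : ℕ} (hk : 0 < k) (hp : 0 < p) {a b : Fin p} (hab : a ≠ b) :
    ep p a b = ∑ u : Fin k × Fin k, ep (k * p) (liftV a u.1) (liftV b u.2) := by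
  funext x y
  rw [Finset.sum_apply, Finset.sum_apply, ep_eq hab]
  have : ∀ u : Fin k × Fin k, ep (k * p) (liftV a u.1) (liftV b u.2) x y =
      ic (k * p) (liftV a u.1) x * ic (k * p) (liftV b u.2) y +
      ic (k * p) (liftV b u.2) x * ic (k * p) (liftV a u.1) y := fun u =>
    ep_eq (fun h => hab (liftV_inj h).1) x y
  rw [Finset.sum_congr rfl (fun u _ => this u), Finset.sum_add_distrib, Fintype.sum_prod_type,
    Fintype.sum_prod_type_right]
  dsimp only
  rw [← Finset.sum_mul_sum, ← Finset.sum_mul_sum,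
    ← ic_sum hk hp, ← ic_sum hk hp, ← ic_sum hk hp, ← ic_sum hk hp]

theorem ep_symm (q : ℕ) (a b : Fin q) : ep q a b = ep q b a := by
  funext x y
  simp only [ep, or_comm]

theorem ep_graphon (q : ℕ) (a b : Fin q) : ep q a b ∈ Graphons := by
  refine ⟨⟨?_, ?_⟩, ?_⟩
  · have : Function.uncurry (ep q a b) = fun z : ℝ × ℝ =>
      if z ∈ (cell q a ×ˢ cell q b ∪ cell q b ×ˢ cell q a) then (1 : ℝ) else 0 := by
      funext z
      simp [Function.uncurry, ep]
    rw [this]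
    exact Measurable.ite (((measurableSet_cell q a).prod (measurableSet_cell q b)).union
      ((measurableSet_cell q b).prod (measurableSet_cell q a))) measurable_const measurable_const
  · intro x y
    have : ∀ P Q R S : Prop, ((P ∧ Q) ∨ (R ∧ S)) ↔ ((S ∧ R) ∨ (Q ∧ P)) := by tauto
    simp only [ep, this (x ∈ cell q a)]
  · intro x y
    rw [ep]
    split_ifs <;> simp

theorem isKernel_of_graphon {f : Kern} (h : f ∈ Graphons) : IsKernel f :=
  ⟨h.1, 1, fun x y => abs_le.2 ⟨by linarith [(h.2 x y).1], (h.2 x y).2⟩⟩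

/-- The space of kernels. -/
def KSub : Submodule ℝ Kern where
  carrier := {f | IsKernel f}
  add_mem' := by
    rintro f g ⟨⟨hf, hf'⟩, C, hC⟩ ⟨⟨hg, hg'⟩, D, hD⟩
    refine ⟨⟨hf.add hg, fun x y => ?_⟩, C + D, fun x y => ?_⟩
    · simp [hf' x y, hg' x y]
    · exact (abs_add_le _ _).trans (add_le_add (hC x y) (hD x y))
  zero_mem' := ⟨⟨measurable_const, fun _ _ => rfl⟩, 0, fun _ _ => by simp⟩
  smul_mem' := by
    rintro c f ⟨⟨hf, hf'⟩, C, hC⟩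
    refine ⟨⟨hf.const_smul c, fun x y => ?_⟩, |c| * C, fun x y => ?_⟩
    · simp [hf' x y]
    · simp only [Pi.smul_apply, smul_eq_mul, abs_mul]
      exact mul_le_mul_of_nonneg_left (hC x y) (abs_nonneg c)

theorem coe_update {n : ℕ} [inst : DecidableEq (Fin n)] (g : Fin n → KSub) (i : Fin n) (u : KSub) :
    (fun j => ((@Function.update _ _ inst g i u j : KSub) : Kern)) =
      @Function.update _ (fun _ => Kern) (instDecidableEqFin n) (fun j => (g j : Kern)) i
        (u : Kern) := by
  obtain rfl : inst = instDecidableEqFin n := Subsingleton.elim _ _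
  funext j
  by_cases h : j = i
  · subst h; simp
  · simp [Function.update_of_ne h]

/-- The bundled multilinear map. -/
def LMul (n : ℕ) (Λ : (Fin n → Kern) → ℝ) (h : MultilinearOnKerns n Λ) :
    MultilinearMap ℝ (fun _ : Fin n => KSub) ℝ where
  toFun g := Λ (fun j => (g j : Kern))
  map_update_add' := by
    intro _ g i u v
    rw [coe_update, coe_update, coe_update]
    exact h.1 _ (fun j => (g j).2) i u v u.2 v.2
  map_update_smul' := by
    intro _ g i c u
    rw [coe_update, coe_update]
    exact h.2 _ (fun j => (g j).2) i c u u.2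

theorem expand {n k p : ℕ} (hk : 0 < k) (hp : 0 < p) (Λ : (Fin n → Kern) → ℝ)
    (hΛ : MultilinearOnKerns n Λ) (x : Fin n → Fin p × Fin p) (hx : ValidTuple p n x) :
    Λ (fun l => ep p (x l).1 (x l).2) = ∑ u : Fin n → Fin k × Fin k,
      Λ (fun l => ep (k * p) (liftV (x l).1 (u l).1) (liftV (x l).2 (u l).2)) := by
  have h := (LMul n Λ hΛ).map_sum (α := fun _ => Fin k × Fin k) (fun l u =>
    (⟨ep (k * p) (liftV (x l).1 u.1) (liftV (x l).2 u.2),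
      isKernel_of_graphon (ep_graphon _ _ _)⟩ : KSub))
  have h2 : (fun l => ep p (x l).1 (x l).2) = fun l => ((∑ u : Fin k × Fin k,
    (⟨ep (k * p) (liftV (x l).1 u.1) (liftV (x l).2 u.2),
      isKernel_of_graphon (ep_graphon _ _ _)⟩ : KSub) : KSub) : Kern) := by
    funext l
    rw [ep_sum hk hp (hx l)]
    simp
  rw [h2]
  exact h

/-- The cell-permuting map. -/
noncomputable def sig (q : ℕ) (ρ : Equiv.Perm (Fin q)) (x : ℝ) : ℝ :=
  x + ∑ a : Fin q, (cell q a).indicator (fun _ => (((ρ a : ℕ) : ℝ) - ((a : ℕ) : ℝ)) / q) x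

theorem sig_of_mem {q : ℕ} (ρ : Equiv.Perm (Fin q)) {x : ℝ} {a : Fin q} (h : x ∈ cell q a) :
    sig q ρ x = x + (((ρ a : ℕ) : ℝ) - ((a : ℕ) : ℝ)) / q := by
  rw [sig, Finset.sum_eq_single a]
  · rw [Set.indicator_of_mem h]
  · intro b _ hb
    rw [Set.indicator_of_notMem]
    exact fun h' => hb (cell_unique h' h)
  · simp

theorem sig_of_not {q : ℕ} (ρ : Equiv.Perm (Fin q)) {x : ℝ} (h : ∀ a, x ∉ cell q a) :
    sig q ρ x = x := by
  rw [sig, Finset.sum_eq_zero, add_zero]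
  intro a _
  exact Set.indicator_of_notMem (h a) _

theorem shift_mem {q : ℕ} (a b : Fin q) (x : ℝ) :
    x + (((b : ℕ) : ℝ) - ((a : ℕ) : ℝ)) / q ∈ cell q b ↔ x ∈ cell q a := by
  simp only [cell, Set.mem_Ioc, sub_div, add_div]
  constructor <;> rintro ⟨h1, h2⟩ <;> constructor <;> linarith

theorem sig_mem_iff {q : ℕ} (ρ : Equiv.Perm (Fin q)) (x : ℝ) (a : Fin q) :
    sig q ρ x ∈ cell q (ρ a) ↔ x ∈ cell q a := by
  constructor
  · intro h
    by_cases hx : ∃ b, x ∈ cell q b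
    · obtain ⟨b, hb⟩ := hx
      have h1 : sig q ρ x ∈ cell q (ρ b) := by
        rw [sig_of_mem ρ hb]; exact (shift_mem _ _ _).2 hb
      have := ρ.injective (cell_unique h h1)
      rwa [this]
    · push Not at hx
      rw [sig_of_not ρ hx] at h
      exact absurd h (hx _)
  · intro h
    rw [sig_of_mem ρ h]
    exact (shift_mem _ _ _).2 h

theorem sig_inv {q : ℕ} (ρ : Equiv.Perm (Fin q)) (x : ℝ) : sig q ρ.symm (sig q ρ x) = x := by
  by_cases hx : ∃ b, x ∈ cell q b
  · obtain ⟨b, hb⟩ := hx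
    rw [sig_of_mem ρ.symm ((sig_mem_iff ρ x b).2 hb), sig_of_mem ρ hb, Equiv.symm_apply_apply]
    ring
  · push Not at hx
    rw [sig_of_not ρ hx, sig_of_not _ hx]

theorem sig_measurable {q : ℕ} (ρ : Equiv.Perm (Fin q)) : Measurable (sig q ρ) := by
  unfold sig
  refine measurable_id.add (Finset.measurable_fun_sum _ fun a _ => ?_)
  exact measurable_const.indicator (measurableSet_cell q a)

theorem sig_maps {q : ℕ} (hq : 0 < q) (ρ : Equiv.Perm (Fin q)) :
    Set.MapsTo (sig q ρ) (Set.Icc 0 1) (Set.Icc 0 1) := by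
  intro x hx
  by_cases h : ∃ b, x ∈ cell q b
  · obtain ⟨b, hb⟩ := h
    have h1 := (sig_mem_iff ρ x b).2 hb
    have h2 : sig q ρ x ∈ ⋃ a : Fin q, cell q a := Set.mem_iUnion.2 ⟨_, h1⟩
    rw [iUnion_cell hq] at h2
    exact Set.Ioc_subset_Icc_self h2
  · push Not at h
    rwa [sig_of_not ρ h]

theorem mu01_apply {q : ℕ} (hq : 0 < q) {s : Set ℝ} (hs : MeasurableSet s) :
    μ01 s = ∑ a : Fin q, volume (s ∩ cell q a) := by
  have h1 : μ01 = volume.restrict (⋃ a : Fin q, cell q a) := by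
    rw [iUnion_cell hq]
    exact Measure.restrict_congr_set Ioc_ae_eq_Icc.symm
  rw [h1, Measure.restrict_iUnion_apply _ (measurableSet_cell q) hs, tsum_fintype]
  · exact Finset.sum_congr rfl fun a _ => Measure.restrict_apply hs
  · intro a b hab
    exact Set.disjoint_left.2 fun x ha hb => hab (cell_unique ha hb)

theorem sig_MPB {q : ℕ} (hq : 0 < q) (ρ : Equiv.Perm (Fin q)) : IsMPB (sig q ρ) := by
  refine ⟨⟨sig_measurable ρ, ?_⟩, sig_maps hq ρ, ?_, ?_⟩
  · ext s hs
    rw [Measure.map_apply (sig_measurable ρ) hs, mu01_apply hq (sig_measurable ρ hs),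
      mu01_apply hq hs, ← Equiv.sum_comp ρ (fun a => volume (s ∩ cell q a))]
    refine Finset.sum_congr rfl fun a _ => ?_
    have : sig q ρ ⁻¹' s ∩ cell q a =
        (fun x => x + (((ρ a : ℕ) : ℝ) - ((a : ℕ) : ℝ)) / q) ⁻¹' (s ∩ cell q (ρ a)) := by
      ext x
      simp only [Set.mem_inter_iff, Set.mem_preimage, shift_mem]
      refine and_congr_left fun hx => ?_
      rw [sig_of_mem ρ hx]
    rw [this, measure_preimage_add_right]
  · intro x _ y _ hxy
    rw [← sig_inv ρ x, ← sig_inv ρ y, hxy]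
  · intro x hx
    exact ⟨sig q ρ.symm x, sig_maps hq ρ.symm hx, sig_inv ρ.symm x⟩

theorem translate_ep {q : ℕ} (ρ : Equiv.Perm (Fin q)) (a b : Fin q) :
    Kern.translate (sig q ρ) (ep q (ρ a) (ρ b)) = ep q a b := by
  funext x y
  simp only [Kern.translate, ep, sig_mem_iff]

theorem iso_invariant {n q : ℕ} (hq : 0 < q) (Λ : (Fin n → Kern) → ℝ) (hS : SymmFunc n Λ)
    (hI : SInvFunc n Λ) (z y : Fin n → Fin q × Fin q) (hz : ValidTuple q n z)
    (hy : ValidTuple q n y) (h : MGIso (tupleMG q n z hz) (tupleMG q n y hy)) :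
    Λ (fun l => ep q (z l).1 (z l).2) = Λ (fun l => ep q (y l).1 (y l).2) := by
  obtain ⟨⟨v, e, hc⟩, hv, he⟩ := h
  have hv : Function.Bijective v := hv
  have he : Function.Bijective e := he
  let ρ : Equiv.Perm (Fin q) := Equiv.ofBijective v hv
  let τ : Equiv.Perm (Fin n) := Equiv.ofBijective e he
  have hc' : ∀ l : Fin n, ep q (y (τ l)).1 (y (τ l)).2 = ep q (ρ (z l).1) (ρ (z l).2) := by
    intro l
    have h1 : s((y (τ l)).1, (y (τ l)).2) = s(ρ (z l).1, ρ (z l).2) :=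
      (aux_pair_eq _ _ _ _).1 (hc l)
    rcases Sym2.eq_iff.1 h1 with h1 | h1
    · rw [h1.1, h1.2]
    · rw [h1.1, h1.2, ep_symm]
  have h1 := hS (fun l => ep q (y l).1 (y l).2) (fun _ => ep_graphon _ _ _) τ
  have h2 := hI (fun l => ep q (ρ (z l).1) (ρ (z l).2)) (fun _ => ep_graphon _ _ _) _
    (sig_MPB hq ρ)
  simp only [translate_ep] at h2
  rw [h2, ← h1]
  congr 1
  funext l
  exact (hc' l).symm

theorem consistency {n k : ℕ} (hk : 1 ≤ k) : ConsistencyMatrix n k (piM k) := by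
  refine ⟨fun G G' H H' hG hH => piM_congr hk ((StripEquiv_iff _ _).1 hG)
    ((StripEquiv_iff _ _).1 hH), ?_⟩
  intro p hp Λ hS hI hM x hx m y hy hne hex
  have hp0 : 0 < p := by omega
  have hq : 0 < k * p := Nat.mul_pos hk hp0
  rw [expand hk hp0 Λ hM x hx]
  let B : (Fin n → Fin k × Fin k) → MG := fun u => blow k (tupleMG p n x hx) u
  have hpi : ∀ i, ((piM k (tupleMG p n x hx) (tupleMG (k*p) n (y i) (hy i)) : ℕ) : ℝ) =
      ∑ u : Fin n → Fin k × Fin k,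
        if PE (B u) (tupleMG (k*p) n (y i) (hy i)) then (1 : ℝ) else 0 := by
    intro i
    rw [Finset.sum_boole]
    rfl
  simp only [hpi, Finset.sum_mul]
  rw [Finset.sum_comm]
  refine Finset.sum_congr rfl fun u _ => ?_
  have hz : ValidTuple (k * p) n (fun l => (liftV (x l).1 (u l).1, liftV (x l).2 (u l).2)) :=
    fun l h => hx l (liftV_inj h).1
  obtain ⟨i, hi⟩ := hex _ hz
  have hB : MGIso (B u) (tupleMG (k*p) n (y i) (hy i)) := hi
  rw [Finset.sum_eq_single i]
  · rw [if_pos (PE_of_MGIso hB), one_mul]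
    exact iso_invariant hq Λ hS hI _ _ hz (hy i) hi
  · intro j _ hj
    rw [if_neg, zero_mul]
    intro hPE
    exact hne j i hj (MGIso_of_PE (hPE.symm.trans (PE_of_MGIso hB)) rfl)
  · simp

end Stmt9Aux


/-- Consistency relations. For `n, k ≥ 1` there is a matrix
`π_{n,k}` with nonnegative integer entries, indexed by isomorphism classes of
multigraphs with `n` edges and no isolated vertices (encoded as a strip-invariant
function on pairs of multigraphs), such that for every `p ≥ 2`, every symmetric
`S_[0,1]`-invariant multilinear `Λ : W^n → ℝ`, every `x ∈ E_p^n` and every complete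
system of representatives `h` of the classes of multigraphs with `n` edges on `kp`
vertices, `C_{n,p}(Λ)(Γ(x)) = Σ_h π(Γ(x)∼, h∼) C_{n,kp}(Λ)(h)`.  Moreover
`π(g̃, h̃) ≠ 0` only if some member of `h̃` surjects onto some member of `g̃`, and the
diagonal entries are positive. -/
theorem stmt9 (n k : ℕ) (hn : 1 ≤ n) (hk : 1 ≤ k) :
    ∃ π : MG → MG → ℕ,
      ConsistencyMatrix n k π ∧
      (∀ G H : MG, G.ne = n → H.ne = n → π G H ≠ 0 →
        ∃ G' H' : MG, NoIsolated G' ∧ NoIsolated H' ∧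
          StripEquiv G' G ∧ StripEquiv H' H ∧ ∃ φ : MGHom H' G', φ.Surj) ∧
      (∀ G : MG, G.ne = n → 0 < π G G) := by
  exact ⟨piM k, consistency hk, fun G H _ _ h => surj_part G H h, fun G _ => piM_pos hk G⟩
end
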